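/- arXiv:2401.08208 — 3 statements merged into one kernel-verified Lean document; each statement's English description precedes it below -/
import Mathlib

section
/- Let k ≥ 3 and A = {a_1 < a_2 < ... < a_k} be a set of k positive integers with gcd(A) = 1. If a_k ≤ 2k - 3, then |S(A)| ≥ a_k + k(k-1)/2; if a_k ≥ 2k - 2, then |S(A)| ≥ θ(k+1) - 4 + k(k-1)/2, where θ = (1+√5)/2. -/
open Pointwise

/-- Set of all nonempty subset sums of a finite set of integers. -/
def SetSub (A : Finset ℤ) : Finset ℤ :=
  (A.powerset.filter (fun B => B.Nonempty)).image fun B => B.sum id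

/-- Set of all subset sums over subsets of cardinality at least `α`. -/
def SetSubAlpha (α : ℕ) (A : Finset ℤ) : Finset ℤ :=
  (A.powerset.filter (fun B => α ≤ B.card)).image fun B => B.sum id

/-- Set of all nonempty subsequence (sub-multiset) sums of a multiset of integers. -/
def SeqSub (A : Multiset ℤ) : Finset ℤ :=
  ((A.powerset.filter (fun B => B ≠ 0)).map Multiset.sum).toFinset

/-- Set of all sub-multiset sums with at least `α` terms. -/
def SeqSubAlpha (α : ℕ) (A : Multiset ℤ) : Finset ℤ :=
  ((A.powerset.filter (fun B => α ≤ Multiset.card B)).map Multiset.sum).toFinset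

/-- `h`-fold sumset of a finite set of integers. -/
def hfold : ℕ → Finset ℤ → Finset ℤ
  | 0, _ => {0}
  | n + 1, X => X + hfold n X

/-- Restricted 2-fold sumset: sums of two distinct elements. -/
def Res2 (A : Finset ℤ) : Finset ℤ :=
  ((A ×ˢ A).filter (fun p => p.1 ≠ p.2)).image fun p => p.1 + p.2

/-- The golden ratio. -/
noncomputable def theta : ℝ := (1 + Real.sqrt 5) / 2

namespace Finset

section SubsetSum

variable {M : Type*} [AddCommGroup M]

/-- A set that is invariant under a generating set is invariant under the whole group. -/
lemma mem_of_invariant_of_closure_eq_top {B X : Finset M}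
    (hB : AddSubgroup.closure (B : Set M) = ⊤) (hX : ∀ b ∈ B, ∀ x, x ∈ X ↔ x + b ∈ X)
    {x : M} (hx : x ∈ X) (y : M) : y ∈ X := by
  have key : ∀ g : M, ∀ x, x ∈ X ↔ x + g ∈ X := fun g => by
    have hg : g ∈ AddSubgroup.closure (B : Set M) := hB ▸ AddSubgroup.mem_top g
    induction hg using AddSubgroup.closure_induction with
    | mem g hg => exact hX g hg
    | zero => simp
    | add g h _ _ ihg ihh => intro x; rw [ihg, ihh, add_assoc]
    | neg g _ ih => intro x; rw [ih (x + -g), neg_add_cancel_right]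
  have := (key (y - x) x).mp hx
  rwa [add_sub_cancel] at this

variable [DecidableEq M]

lemma add_mem_subsetSum_of_mem_erase {B : Finset M} {b x : M} (hb : b ∈ B)
    (hx : x ∈ (B.erase b).subsetSum) : x + b ∈ B.subsetSum := by
  obtain ⟨C, hC, rfl⟩ := mem_subsetSum_iff.mp hx
  have hbC : b ∉ C := fun h => notMem_erase b B (hC h)
  refine mem_subsetSum_iff.mpr ⟨insert b C, ?_, by rw [sum_insert hbC, add_comm]⟩
  exact insert_subset hb (hC.trans (erase_subset _ _))

/-- The elements of `X` whose translate by `b` leaves `X`. -/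
def exits (X : Finset M) (b : M) : Finset M := X.filter (· + b ∉ X)

lemma mem_exits {X : Finset M} {b x : M} : x ∈ X.exits b ↔ x ∈ X ∧ x + b ∉ X := mem_filter

lemma card_exits_neg (X : Finset M) (b : M) : #(X.exits (-b)) = #(X.exits b) := by
  have h₁ := card_filter_add_card_filter_not (s := X) (· + b ∈ X)
  have h₂ := card_filter_add_card_filter_not (s := X) (· + -b ∈ X)
  have h₃ : #(X.filter (· + b ∈ X)) = #(X.filter (· + -b ∈ X)) := by
    refine card_bij' (fun x _ => x + b) (fun x _ => x + -b) ?_ ?_ ?_ ?_ <;>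
      simp +contextual
  unfold exits
  lia

/-- Points of `(B.erase b).subsetSum` stay inside `B.subsetSum` when translated by `b`. -/
lemma card_subsetSum_erase_add_card_exits_le {B : Finset M} {b : M} (hb : b ∈ B) :
    #(B.erase b).subsetSum + #(B.subsetSum.exits b) ≤ #B.subsetSum := by
  rw [← card_union_of_disjoint]
  · exact card_le_card (union_subset (subsetSum_mono (erase_subset _ _)) (filter_subset _ _))
  · refine disjoint_left.mpr fun x hx hx' => (mem_exits.mp hx').2 ?_
    exact add_mem_subsetSum_of_mem_erase hb hx

/-- Adding an element `b` gains at least the number of points at which the old set of subset sums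
is left by translation by `b`. -/
lemma card_subsetSum_add_card_exits_le_insert {B : Finset M} {b : M} (hb : b ∉ B) :
    #B.subsetSum + #(B.subsetSum.exits b) ≤ #(insert b B).subsetSum := by
  have he : (insert b B).erase b = B := erase_insert hb
  rw [← card_image_of_injective (B.subsetSum.exits b) (add_left_injective b),
    ← card_union_of_disjoint]
  · refine card_le_card (union_subset (subsetSum_mono (subset_insert _ _)) ?_)
    refine image_subset_iff.mpr fun x hx => ?_
    exact add_mem_subsetSum_of_mem_erase (mem_insert_self b B)
      (by rw [he]; exact (mem_exits.mp hx).1)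
  · refine disjoint_right.mpr fun x hx hxB => ?_
    obtain ⟨y, hy, rfl⟩ := mem_image.mp hx
    exact (mem_exits.mp hy).2 hxB

/-- Translation by `b` moves exactly the point `u` out of `X`, translation by `-b` exactly `v`. -/
def HasUniqueExits (X : Finset M) (b u v : M) : Prop := X.exits b = {u} ∧ X.exits (-b) = {v}

namespace HasUniqueExits

variable {X : Finset M} {b c u v u' v' : M}

lemma neg (h : X.HasUniqueExits b u v) : X.HasUniqueExits (-b) v u :=
  ⟨h.2, by rw [neg_neg]; exact h.1⟩

lemma mem (h : X.HasUniqueExits b u v) : u ∈ X ∧ u + b ∉ X :=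
  mem_exits.mp (h.1 ▸ mem_singleton_self u)

lemma add_mem (h : X.HasUniqueExits b u v) {x : M} (hx : x ∈ X) (hne : x ≠ u) : x + b ∈ X := by
  by_contra hn
  exact hne (mem_singleton.mp (h.1 ▸ mem_exits.mpr ⟨hx, hn⟩))

lemma sub_mem (h : X.HasUniqueExits b u v) {x : M} (hx : x ∈ X) (hne : x ≠ v) : x - b ∈ X := by
  simpa [sub_eq_add_neg] using h.neg.add_mem hx hne

lemma eq_or_eq (hb : X.HasUniqueExits b u v) (hc : X.HasUniqueExits c u' v') (hc0 : c ≠ 0) :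
    u = u' ∨ v' = u + b + c := by
  by_contra! h
  have h₁ := hc.add_mem hb.mem.1 h.1
  have h₂ := hb.add_mem h₁ (by simpa using hc0)
  rw [add_right_comm] at h₂
  have h₃ := hc.sub_mem h₂ h.2.symm
  rw [add_sub_cancel_right] at h₃
  exact hb.mem.2 h₃

lemma dichotomy (hb : X.HasUniqueExits b u v) (hc : X.HasUniqueExits c u' v')
    (hb0 : b ≠ 0) (hc0 : c ≠ 0) (hbc : b ≠ c) (hbc' : c ≠ -b) :
    (v = u ∧ u' = u ∧ v' = u) ∨ (u + b = u' + c ∧ v = u + b + b ∧ v' = u + b + c) := by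
  have h₁ := hb.eq_or_eq hc hc0
  have h₂ := hc.eq_or_eq hb hb0
  have h₃ := hb.eq_or_eq hc.neg (neg_ne_zero.mpr hc0)
  have h₄ := hc.eq_or_eq hb.neg (neg_ne_zero.mpr hb0)
  have h₅ : b + c ≠ 0 := fun h => hbc' (eq_neg_of_add_eq_zero_right h)
  grind

end HasUniqueExits

/-- If every element of the generating set `B` moves at most one point out of `X`, then `X` is
almost the whole group. -/
lemma card_le_card_add_one_of_exits_le_one [Fintype M]
    (htor : ∀ x y : M, x ≠ 0 → y ≠ 0 → x + x = 0 → y + y = 0 → x = y) {B X : Finset M}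
    (hB : AddSubgroup.closure (B : Set M) = ⊤) (hB0 : (0 : M) ∉ B) (hB3 : 3 ≤ #B)
    (hX : 1 < #X) (hle : ∀ b ∈ B, #(X.exits b) ≤ 1) :
    Fintype.card M ≤ #X + 1 := by
  have hne0 : ∀ b ∈ B, b ≠ 0 := fun b hb h => hB0 (h ▸ hb)
  obtain ⟨x₀, hx₀⟩ : X.Nonempty := card_pos.mp (by lia)
  by_cases hall : ∃ d ∈ B, X.exits d = ∅
  · obtain ⟨d, hd, hd0⟩ := hall
    have hadd : ∀ x ∈ X, x + d ∈ X := fun x hx => by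
      by_contra hn
      have : x ∈ X.exits d := mem_exits.mpr ⟨hx, hn⟩
      simp [hd0] at this
    have hsub : ∀ x ∈ X, x - d ∈ X := fun x hx => by
      by_contra hn
      have h : x ∈ X.exits (-d) := mem_exits.mpr ⟨hx, by rwa [← sub_eq_add_neg]⟩
      have h' := card_exits_neg X d
      rw [hd0, card_empty, card_eq_zero] at h'
      simp [h'] at h
    have hinv : ∀ b ∈ B, ∀ x ∈ X, x + b ∈ X := fun b hb x hx => by
      by_contra hn
      have h₁ : x ∈ X.exits b := mem_exits.mpr ⟨hx, hn⟩
      have h₂ : x + d ∈ X.exits b := mem_exits.mpr ⟨hadd x hx, fun h => hn (by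
        have := hsub _ h; rwa [show x + d + b - d = x + b by abel] at this)⟩
      have := card_le_one.mp (hle b hb) _ h₁ _ h₂
      exact hne0 d hd (by simpa using this)
    have hinv' : ∀ b ∈ B, ∀ x, x ∈ X ↔ x + b ∈ X := fun b hb x => by
      refine ⟨hinv b hb x, fun h => ?_⟩
      by_contra hn
      have h₁ : x + b ∈ X.exits (-b) := mem_exits.mpr ⟨h, by rwa [add_neg_cancel_right]⟩
      have h₂ : X.exits b = ∅ := filter_eq_empty_iff.mpr fun y hy => not_not.mpr (hinv b hb y hy)
      have h₃ := card_exits_neg X b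
      rw [h₂, card_empty, card_eq_zero] at h₃
      simp [h₃] at h₁
    have : X = univ := eq_univ_of_forall (mem_of_invariant_of_closure_eq_top hB hinv' hx₀)
    simp [this]
  push Not at hall
  have huv : ∀ b ∈ B, ∃ u v, X.HasUniqueExits b u v := fun b hb => by
    have h₁ : #(X.exits b) = 1 := le_antisymm (hle b hb) (card_pos.mpr (hall b hb))
    obtain ⟨u, hu⟩ := card_eq_one.mp h₁
    obtain ⟨v, hv⟩ := card_eq_one.mp ((card_exits_neg X b).trans h₁)
    exact ⟨u, v, hu, hv⟩
  obtain ⟨b, hb, hbb⟩ : ∃ b ∈ B, b + b ≠ 0 := by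
    by_contra! h
    have : #B ≤ 1 := card_le_one.mpr fun x hx y hy =>
      htor x y (hne0 x hx) (hne0 y hy) (h x hx) (h y hy)
    lia
  obtain ⟨u, v, huv_b⟩ := huv b hb
  have hpair : ∀ c ∈ B, c ≠ b → c ≠ -b → ∃ u' v', X.HasUniqueExits c u' v' ∧
      ((v = u ∧ u' = u ∧ v' = u) ∨ (u + b = u' + c ∧ v = u + b + b ∧ v' = u + b + c)) :=
    fun c hc h₁ h₂ => by
      obtain ⟨u', v', h⟩ := huv c hc
      exact ⟨u', v', h, huv_b.dichotomy h (hne0 b hb) (hne0 c hc) h₁.symm h₂⟩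
  by_cases hvu : v = u
  · subst hvu
    have hpoint : ∀ c ∈ B, X.HasUniqueExits c v v := fun c hc => by
      by_cases h₁ : c = b
      · exact h₁ ▸ huv_b
      by_cases h₂ : c = -b
      · exact h₂ ▸ huv_b.neg
      obtain ⟨u', v', h, ⟨-, rfl, rfl⟩ | ⟨-, h', -⟩⟩ := hpair c hc h₁ h₂
      · exact h
      · rw [add_assoc] at h'
        exact absurd (by simpa using h') hbb
    obtain ⟨y, hy, hyv⟩ := exists_mem_ne hX v
    have : v ∈ X.erase v := by
      refine mem_of_invariant_of_closure_eq_top hB (fun c hc x => ?_) (mem_erase.mpr ⟨hyv, hy⟩) v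
      have h := hpoint c hc
      simp only [mem_erase]
      refine ⟨fun ⟨h₁, h₂⟩ => ⟨fun h₃ => ?_, h.add_mem h₂ h₁⟩, fun ⟨h₁, h₂⟩ => ⟨fun h₃ => ?_, ?_⟩⟩
      · have := h.neg.mem.2
        rw [← h₃, add_neg_cancel_right] at this
        exact this h₂
      · exact h.mem.2 (h₃ ▸ h₂)
      · simpa using h.sub_mem h₂ h₁
    simp at this
  · obtain ⟨c, hc, hcb⟩ : ∃ c ∈ B, c ∉ ({b, -b} : Finset M) := by
      by_contra! h
      have := card_le_card (show B ⊆ {b, -b} from h)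
      have := card_le_two (a := b) (b := -b)
      lia
    simp only [mem_insert, mem_singleton, not_or] at hcb
    have hv : v = u + b + b := by
      obtain ⟨_, _, -, ⟨h, -⟩ | ⟨-, h, -⟩⟩ := hpair c hc hcb.1 hcb.2
      · exact absurd h hvu
      · exact h
    have hpoint : ∀ c ∈ B, X.HasUniqueExits c (u + b - c) (u + b + c) := fun c hc => by
      by_cases h₁ : c = b
      · rw [h₁, add_sub_cancel_right, ← hv]
        exact huv_b
      by_cases h₂ : c = -b
      · rw [h₂, sub_neg_eq_add, ← hv, add_neg_cancel_right]
        exact huv_b.neg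
      obtain ⟨u', v', h, ⟨h', -⟩ | ⟨h', -, rfl⟩⟩ := hpair c hc h₁ h₂
      · exact absurd h' hvu
      · rwa [h', add_sub_cancel_right, ← h']
    have : insert (u + b) X = univ := by
      refine eq_univ_of_forall
        (mem_of_invariant_of_closure_eq_top hB (fun c hc x => ?_) (mem_insert_of_mem hx₀))
      have h := hpoint c hc
      simp only [mem_insert]
      refine ⟨?_, ?_⟩
      · rintro (rfl | hx)
        · exact .inr h.neg.mem.1
        · by_cases hxu : x = u + b - c
          · exact .inl (by rw [hxu, sub_add_cancel])
          · exact .inr (h.add_mem hx hxu)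
      · rintro (hx | hx)
        · exact .inr (eq_sub_of_add_eq hx ▸ h.mem.1)
        · by_cases hxu : x = u + b
          · exact .inl hxu
          · have := h.sub_mem hx (by simpa using hxu)
            exact .inr (by rwa [add_sub_cancel_right] at this)
    rw [← card_univ, ← this]
    exact card_insert_le _ _

/-- Subset sums of a generating set of at most half the size of the group. -/
theorem two_mul_card_le_card_subsetSum_add_one [Fintype M]
    (htor : ∀ x y : M, x ≠ 0 → y ≠ 0 → x + x = 0 → y + y = 0 → x = y) {B : Finset M}
    (hB : AddSubgroup.closure (B : Set M) = ⊤) (hB0 : (0 : M) ∉ B)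
    (hcard : 2 * #B ≤ Fintype.card M) : 2 * #B ≤ #B.subsetSum + 1 := by
  have hins : ∀ C : Finset M, (0 : M) ∉ C → #C + 1 ≤ #C.subsetSum := fun C hC => by
    rw [← card_insert_of_notMem hC]
    exact card_le_card (insert_subset zero_mem_subsetSum subset_subsetSum)
  induction hn : #B generalizing B with
  | zero => simp
  | succ n ih =>
    have hbase := hins B hB0
    by_cases hB3 : 3 ≤ #B
    swap
    · lia
    by_cases hle : ∀ b ∈ B, #(B.subsetSum.exits b) ≤ 1
    · have := card_le_card_add_one_of_exits_le_one htor hB hB0 hB3 (by lia) hle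
      lia
    push Not at hle
    obtain ⟨b, hb, hb2⟩ := hle
    have herase : #(B.erase b) = n := by rw [card_erase_of_mem hb, hn, Nat.add_sub_cancel]
    have hE0 : (0 : M) ∉ B.erase b := fun h => hB0 (mem_of_mem_erase h)
    by_cases hgen : AddSubgroup.closure (B.erase b : Set M) = ⊤
    · have h₁ := ih (B := B.erase b) (by exact_mod_cast hgen) hE0 (by lia) herase
      have h₂ := card_subsetSum_erase_add_card_exits_le hb
      lia
    set K := AddSubgroup.closure (B.erase b : Set M)
    have hbK : b ∉ K := fun h => hgen <| by
      rw [eq_top_iff, ← hB, AddSubgroup.closure_le]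
      intro x hx
      by_cases hxb : x = b
      · exact hxb ▸ h
      · exact AddSubgroup.subset_closure (by exact_mod_cast mem_erase.mpr ⟨hxb, hx⟩)
    have hsumK : ∀ x ∈ (B.erase b).subsetSum, x ∈ K := fun x hx => by
      obtain ⟨C, hC, rfl⟩ := mem_subsetSum_iff.mp hx
      exact sum_mem fun y hy => AddSubgroup.subset_closure (by exact_mod_cast hC hy)
    have hexit : (B.erase b).subsetSum.exits b = (B.erase b).subsetSum :=
      filter_true_of_mem fun x hx hxb =>
        hbK ((K.add_mem_cancel_left (hsumK x hx)).mp (hsumK _ hxb))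
    have h₁ := card_subsetSum_add_card_exits_le_insert (notMem_erase b B)
    rw [insert_erase hb, hexit] at h₁
    have h₂ := hins _ hE0
    lia

/-- Subset sums of a set of more than half the size of the group cover the group. -/
theorem subsetSum_eq_univ [Fintype M]
    (htor : ∀ x y : M, x ≠ 0 → y ≠ 0 → x + x = 0 → y + y = 0 → x = y) {B : Finset M}
    (hB0 : (0 : M) ∉ B) (hcard : Fintype.card M + 1 ≤ 2 * #B) : B.subsetSum = univ := by
  refine eq_univ_of_forall fun c => ?_
  set D := insert 0 B with hD
  have hDcard : #D = #B + 1 := card_insert_of_notMem hB0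
  have hrep : 2 < #(D ∩ D.image (c - ·)) := by
    have h₁ := card_union_add_card_inter D (D.image (c - ·))
    rw [card_image_of_injective _ sub_right_injective] at h₁
    have h₂ := card_le_univ (D ∪ D.image (c - ·))
    lia
  obtain ⟨x, y, z, hx, hy, hz, hxy, hxz, hyz⟩ := two_lt_card_iff.mp hrep
  obtain ⟨x, hx, hxc⟩ : ∃ x ∈ D ∩ D.image (c - ·), x ≠ c - x := by
    by_contra! h
    have h₁ := h x hx
    have h₂ := h y hy
    have h₃ := h z hz
    have := htor (x - y) (x - z) (sub_ne_zero.mpr hxy) (sub_ne_zero.mpr hxz) (by grind) (by grind)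
    exact hyz (sub_right_injective this)
  obtain ⟨hxD, hx'⟩ := mem_inter.mp hx
  obtain ⟨w, hw, rfl⟩ := mem_image.mp hx'
  rw [← erase_insert hB0, subsetSum_erase_zero]
  exact mem_subsetSum_iff.mpr ⟨{c - w, w}, by simp [insert_subset_iff, hxD, hw, ← hD],
    by rw [sum_pair (by simpa using hxc)]; abel⟩

end SubsetSum

end Finset

lemma ZMod.eq_of_add_self_eq_zero {m : ℕ} [NeZero m] (x y : ZMod m) (hx : x ≠ 0) (hy : y ≠ 0)
    (hxx : x + x = 0) (hyy : y + y = 0) : x = y := by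
  have key : ∀ z : ZMod m, z ≠ 0 → z + z = 0 → 2 * z.val = m := fun z hz hzz => by
    have h₁ : m ∣ z.val + z.val := by
      rw [← ZMod.natCast_eq_zero_iff, Nat.cast_add, ZMod.natCast_zmod_val, hzz]
    have h₂ := z.val_lt
    have h₃ : 0 < z.val := by rwa [ZMod.val_pos]
    obtain ⟨t, ht⟩ := h₁
    have : t < 2 := by nlinarith
    interval_cases t <;> lia
  exact ZMod.val_injective m (by have := key x hx hxx; have := key y hy hyy; lia)

namespace Finset

/-- Adjoining a modulus `m` to a set of integers increases the number of subset sums at least by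
the number of residues modulo `m` that are subset sums. -/
lemma card_subsetSum_add_card_subsetSum_image_cast_le {A : Finset ℤ} {m : ℕ} (hm : (m : ℤ) ∉ A)
    (hinj : Set.InjOn (Int.cast : ℤ → ZMod m) A) (hm0 : 0 < m) :
    #A.subsetSum + #(A.image (Int.cast : ℤ → ZMod m)).subsetSum
      ≤ #(insert (m : ℤ) A).subsetSum := by
  refine le_trans (Nat.add_le_add_left ?_ _) (card_subsetSum_add_card_exits_le_insert hm)
  refine (card_le_card fun r hr => ?_).trans (card_image_le (f := (Int.cast : ℤ → ZMod m)))
  obtain ⟨C, hC, rfl⟩ := mem_subsetSum_iff.mp hr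
  obtain ⟨D, hD, rfl⟩ := subset_image_iff.mp hC
  have hsum : ∑ b ∈ D.image (Int.cast : ℤ → ZMod m), b = ((∑ b ∈ D, b : ℤ) : ZMod m) := by
    rw [sum_image (hinj.mono (by exact_mod_cast hD)), Int.cast_sum]
  set x := ∑ b ∈ D, b
  have hx : x ∈ A.subsetSum.filter (fun y : ℤ => (y : ZMod m) = x) :=
    mem_filter.mpr ⟨mem_subsetSum_iff.mpr ⟨D, hD, rfl⟩, rfl⟩
  obtain ⟨y, hy, hmax⟩ := exists_max_image _ id ⟨x, hx⟩
  obtain ⟨hyA, hyx⟩ := mem_filter.mp hy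
  rw [hsum]
  refine mem_image.mpr ⟨y, mem_exits.mpr ⟨hyA, fun h => ?_⟩, hyx⟩
  have := hmax (y + m) (mem_filter.mpr ⟨h, by simpa using hyx⟩)
  simp only [id] at this
  lia

/-- A set of integers that together with `m` has no common divisor generates the integers
modulo `m`. -/
lemma closure_image_cast_eq_top {A : Finset ℤ} {m : ℕ}
    (hA : ∀ d : ℤ, d ∣ m → (∀ x ∈ A, d ∣ x) → IsUnit d) :
    AddSubgroup.closure (A.image (Int.cast : ℤ → ZMod m) : Set (ZMod m)) = ⊤ := by
  set K := AddSubgroup.closure (A.image (Int.cast : ℤ → ZMod m) : Set (ZMod m))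
  obtain ⟨d, hd⟩ := Int.subgroup_cyclic (K.comap (Int.castAddHom (ZMod m)))
  have hdvd : ∀ z : ℤ, (z : ZMod m) ∈ K ↔ d ∣ z := fun z => by
    rw [← Int.mem_zmultiples_iff, AddSubgroup.zmultiples_eq_closure, ← hd]
    simp
  have hunit : IsUnit d := by
    refine hA d ((hdvd _).mp (by simp)) fun x hx => (hdvd _).mp (AddSubgroup.subset_closure ?_)
    exact_mod_cast mem_image_of_mem _ hx
  refine eq_top_iff.mpr fun z _ => ?_
  obtain ⟨z, rfl⟩ := ZMod.intCast_surjective z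
  exact (hdvd z).mpr hunit.dvd

end Finset

lemma card_subsetSum_le_card_setSub_add_one (A : Finset ℤ) :
    A.subsetSum.card ≤ (SetSub A).card + 1 := by
  refine (Finset.card_le_card fun x hx => ?_).trans (Finset.card_insert_le 0 (SetSub A))
  obtain ⟨B, hB, rfl⟩ := Finset.mem_subsetSum_iff.mp hx
  obtain rfl | hne := B.eq_empty_or_nonempty
  · simp
  · refine Finset.mem_insert_of_mem (Finset.mem_image.mpr ⟨B, ?_, rfl⟩)
    exact Finset.mem_filter.mpr ⟨Finset.mem_powerset.mpr hB, hne⟩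

lemma theta_lt : theta < 81 / 50 := by
  have : Real.sqrt 5 < 56 / 25 := by
    rw [Real.sqrt_lt' (by norm_num)]
    norm_num
  unfold theta
  linarith

theorem freiman_subset_sum (k : ℕ) (hk : 3 ≤ k) (a : ℕ → ℤ)
    (ha : ∀ i j, 1 ≤ i → i < j → j ≤ k → a i < a j)
    (hpos : ∀ i, 1 ≤ i → i ≤ k → 0 < a i)
    (hgcd : (Finset.Icc 1 k).gcd a = 1) :
    (a k ≤ 2 * (k : ℤ) - 3 →
      a k + (k : ℤ) * ((k : ℤ) - 1) / 2 ≤ ((SetSub ((Finset.Icc 1 k).image a)).card : ℤ)) ∧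
    (2 * (k : ℤ) - 2 ≤ a k →
      theta * ((k : ℝ) + 1) - 4 + (k : ℝ) * ((k : ℝ) - 1) / 2
        ≤ ((SetSub ((Finset.Icc 1 k).image a)).card : ℝ)) := by
  obtain ⟨n, rfl⟩ : ∃ n, k = n + 1 := ⟨k - 1, by lia⟩
  obtain ⟨m, hm⟩ : ∃ m : ℕ, a (n + 1) = m :=
    Int.eq_ofNat_of_zero_le (hpos (n + 1) (by lia) le_rfl).le
  have hm0 : 0 < m := by have := hpos (n + 1) (by lia) le_rfl; lia
  have : NeZero m := ⟨hm0.ne'⟩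
  set A := (Finset.Icc 1 n).image a with hA
  have hmono : Set.InjOn a (Finset.Icc 1 n) := fun i hi j hj hij => by
    simp only [Finset.coe_Icc, Set.mem_Icc] at hi hj
    rcases lt_trichotomy i j with h | h | h
    · exact absurd hij (ha i j hi.1 h (by lia)).ne
    · exact h
    · exact absurd hij (ha j i hj.1 h (by lia)).ne'
  have hAcard : A.card = n := by rw [Finset.card_image_of_injOn hmono, Nat.card_Icc]; lia
  have hAm : ∀ x ∈ A, 0 < x ∧ x < m := fun x hx => by
    obtain ⟨i, hi, rfl⟩ := Finset.mem_image.mp hx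
    rw [Finset.mem_Icc] at hi
    exact ⟨hpos i hi.1 (by lia), hm ▸ ha i (n + 1) hi.1 (by lia) le_rfl⟩
  have hins : (Finset.Icc 1 (n + 1)).image a = insert (m : ℤ) A := by
    rw [← Finset.insert_Icc_right_eq_Icc_add_one (by lia), Finset.image_insert, hm]
  have hinj : Set.InjOn (Int.cast : ℤ → ZMod m) A := fun x hx y hy hxy => by
    have hx := hAm x hx
    have hy := hAm y hy
    rw [ZMod.intCast_eq_intCast_iff'] at hxy
    rwa [Int.emod_eq_of_lt hx.1.le hx.2, Int.emod_eq_of_lt hy.1.le hy.2] at hxy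
  set B := A.image (Int.cast : ℤ → ZMod m) with hB
  have hBcard : B.card = n := by rw [Finset.card_image_of_injOn hinj, hAcard]
  have hB0 : (0 : ZMod m) ∉ B := fun h => by
    obtain ⟨x, hx, hx0⟩ := Finset.mem_image.mp h
    rw [ZMod.intCast_zmod_eq_zero_iff_dvd] at hx0
    have := hAm x hx
    have := Int.le_of_dvd this.1 hx0
    lia
  have hgen : AddSubgroup.closure (B : Set (ZMod m)) = ⊤ :=
    Finset.closure_image_cast_eq_top fun d hdm hd => by
      refine isUnit_of_dvd_one (hgcd ▸ Finset.dvd_gcd fun i hi => ?_)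
      have : a i ∈ insert (m : ℤ) A := hins ▸ Finset.mem_image_of_mem a hi
      rcases Finset.mem_insert.mp this with h | h
      · rwa [h]
      · exact hd _ h
  have hstep := Finset.card_subsetSum_add_card_subsetSum_image_cast_le
    (fun h => (hAm m h).2.false) hinj hm0
  rw [← hB, ← hins] at hstep
  have hS := card_subsetSum_le_card_setSub_add_one ((Finset.Icc 1 (n + 1)).image a)
  have hbase := Finset.card_succ_choose_two_lt_card_subsetSum_of_pos fun x hx => (hAm x hx).1
  rw [hAcard] at hbase
  have htot : (n + 1).choose 2 + B.subsetSum.card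
      ≤ (SetSub ((Finset.Icc 1 (n + 1)).image a)).card := by lia
  have hchoose : (n + 1).choose 2 * 2 = (n + 1) * n := by
    rw [Nat.choose_two_right, Nat.add_sub_cancel]
    exact Nat.div_mul_cancel (Nat.even_mul_pred_self (n + 1)).two_dvd
  have htor := ZMod.eq_of_add_self_eq_zero (m := m)
  refine ⟨fun h => ?_, fun h => ?_⟩
  · have hfull := Finset.subsetSum_eq_univ htor hB0 (by rw [ZMod.card, hBcard]; lia)
    rw [hfull, Finset.card_univ, ZMod.card] at htot
    have hdiv : ((n + 1 : ℕ) : ℤ) * (((n + 1 : ℕ) : ℤ) - 1) / 2 = (n + 1).choose 2 := by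
      refine Int.ediv_eq_of_eq_mul_left two_ne_zero ?_
      push_cast
      rw [add_sub_cancel_right]
      exact_mod_cast hchoose.symm
    rw [hdiv, hm]
    lia
  · have hhalf := Finset.two_mul_card_le_card_subsetSum_add_one htor hgen hB0
      (by rw [ZMod.card, hBcard]; lia)
    rw [hBcard] at hhalf
    have h₁ : (n + 1).choose 2 + 2 * n ≤ (SetSub ((Finset.Icc 1 (n + 1)).image a)).card + 1 := by
      lia
    have h₂ : ((n + 1).choose 2 : ℝ) * 2 = (n + 1) * n := by exact_mod_cast hchoose
    have h₃ : ((n + 1).choose 2 : ℝ) + 2 * n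
        ≤ (SetSub ((Finset.Icc 1 (n + 1)).image a)).card + 1 := by exact_mod_cast h₁
    have hn : (2 : ℝ) ≤ n := by exact_mod_cast (by lia : 2 ≤ n)
    have h₄ : theta * (n + 2) ≤ 81 / 50 * (n + 2) := by gcongr; exact theta_lt.le
    push_cast
    linarith
end

section
/- Let 𝔸 be a finite multiset of positive integers with distinct values a_1 < ... < a_k, multiplicities r_i ≥ 2 for all i, gcd(a_1, ..., a_k) = 1, and r = min{r_1, ..., r_k}. Then |S(𝔸)| ≥ |(r-1)(A ∪ {0})| + min{a_k, r(k-1)+1} - 1 + Σ_{i=1}^{k-1} i·r_i + k(r_k - r), where (r-1)(A ∪ {0}) denotes the (r-1)-fold sumset of A ∪ {0}. -/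
open Pointwise

/-- The `n`-fold sumset of a finite subset of an additive commutative group. -/
def foldSum {G : Type*} [AddCommGroup G] [DecidableEq G] : ℕ → Finset G → Finset G
  | 0, _ => {0}
  | n + 1, X => X + foldSum n X

section FoldSum

variable {G Q : Type*} [AddCommGroup G] [DecidableEq G] [AddCommGroup Q] [DecidableEq Q]

lemma hfold_eq_foldSum (n : ℕ) (X : Finset ℤ) : hfold n X = foldSum n X := by
  induction n with
  | zero => rfl
  | succ n ih => rw [hfold, foldSum, ih]

lemma mem_foldSum_succ {n : ℕ} {X : Finset G} {x : G} :
    x ∈ foldSum (n + 1) X ↔ ∃ a ∈ X, ∃ y ∈ foldSum n X, a + y = x := by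
  rw [foldSum, Finset.mem_add]

lemma foldSum_subset_succ (n : ℕ) {X : Finset G} (h0 : 0 ∈ X) :
    foldSum n X ⊆ foldSum (n + 1) X := fun x hx =>
  mem_foldSum_succ.2 ⟨0, h0, x, hx, zero_add x⟩

lemma foldSum_mono (n : ℕ) {X Y : Finset G} (h : X ⊆ Y) : foldSum n X ⊆ foldSum n Y := by
  induction n with
  | zero => exact subset_rfl
  | succ n ih => exact Finset.add_subset_add h ih

lemma foldSum_nonempty (n : ℕ) {X : Finset G} (h : X.Nonempty) : (foldSum n X).Nonempty := by
  induction n with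
  | zero => exact Finset.singleton_nonempty 0
  | succ n ih => exact h.add ih

lemma image_foldSum (f : G →+ Q) (n : ℕ) (X : Finset G) :
    (foldSum n X).image f = foldSum n (X.image f) := by
  induction n with
  | zero => simp [foldSum]
  | succ n ih => rw [foldSum, foldSum, Finset.image_add, ih]

lemma foldSum_one (X : Finset G) : foldSum 1 X = X := by
  simp [foldSum, Finset.add_singleton]

/-- If a sum of `n + 1` elements is not a sum of `n` elements, then `0` is not used. -/
lemma mem_foldSum_erase_zero {n : ℕ} {X : Finset G} {c : G}
    (hc : c ∈ foldSum (n + 1) X) (hc' : c ∉ foldSum n X) : c ∈ foldSum (n + 1) (X.erase 0) := by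
  induction n generalizing c with
  | zero =>
    rw [zero_add, foldSum_one] at *
    exact Finset.mem_erase.2 ⟨by simpa [foldSum] using hc', hc⟩
  | succ n ih =>
    obtain ⟨x, hx, y, hy, rfl⟩ := mem_foldSum_succ.1 hc
    refine mem_foldSum_succ.2 ⟨x, Finset.mem_erase.2 ⟨?_, hx⟩, y, ih hy ?_, rfl⟩
    · rintro rfl
      exact hc' (by simpa using hy)
    · exact fun h => hc' (mem_foldSum_succ.2 ⟨x, hx, y, h, rfl⟩)

/-- An element all of whose representations start with `t` is a multiple of `t`. -/
lemma eq_nsmul_of_forall_decomposition {n : ℕ} {X : Finset G} {c t : G}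
    (hc : c ∈ foldSum (n + 1) X) (h : ∀ x ∈ X, ∀ y ∈ foldSum n X, x + y = c → x = t) :
    c = (n + 1) • t := by
  induction n generalizing c with
  | zero =>
    rw [zero_add, foldSum_one] at hc
    rw [zero_add, one_nsmul]
    exact h c hc 0 (by simp [foldSum]) (add_zero c)
  | succ n ih =>
    obtain ⟨x, hx, y, hy, rfl⟩ := mem_foldSum_succ.1 hc
    obtain rfl := h x hx y hy rfl
    rw [succ_nsmul', ← ih hy]
    intro x' hx' y' hy' hxy
    exact h x' hx' (x + y') (mem_foldSum_succ.2 ⟨x, hx, y', hy', rfl⟩)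
      (by rw [← hxy, add_left_comm])

/-- In the integers, fibres of an iterated sumset are at least as large as the fibres of the
summands suggest. -/
lemma le_card_filter_foldSum (f : ℤ →+ Q) {X : Finset ℤ} {s : ℕ}
    (hs : ∀ x ∈ X, s ≤ (X.filter fun y => f y = f x).card) {n : ℕ} {c : Q}
    (hc : c ∈ foldSum n (X.image f)) :
    n * s + 1 ≤ ((foldSum n X).filter fun y => f y = c).card + n := by
  induction n generalizing c with
  | zero =>
    simp only [foldSum, Finset.mem_singleton] at hc
    subst hc
    simp [foldSum, Finset.filter_singleton]
  | succ n ih =>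
    obtain ⟨x', hx', y', hy', rfl⟩ := mem_foldSum_succ.1 hc
    obtain ⟨x, hx, rfl⟩ := Finset.mem_image.1 hx'
    rw [← image_foldSum] at hy'
    obtain ⟨y, hy, rfl⟩ := Finset.mem_image.1 hy'
    rw [image_foldSum] at hy'
    have h1 := ih hy'
    have h2 := hs x hx
    have h3 := cauchy_davenport_add_of_linearOrder_isCancelAdd
      (s := X.filter fun z => f z = f x) (t := (foldSum n X).filter fun z => f z = f y)
      ⟨x, by simp [hx]⟩ ⟨y, by simp [hy]⟩
    have h4 : (X.filter fun z => f z = f x) + ((foldSum n X).filter fun z => f z = f y) ⊆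
        (foldSum (n + 1) X).filter fun z => f z = f x + f y := by
      intro z hz
      obtain ⟨u, hu, v, hv, rfl⟩ := Finset.mem_add.1 hz
      rw [Finset.mem_filter] at *
      exact ⟨mem_foldSum_succ.2 ⟨u, hu.1, v, hv.1, rfl⟩, by rw [map_add, hu.2, hv.2]⟩
    have h5 := Finset.card_le_card h4
    have : 1 ≤ (X.filter fun z => f z = f x).card := Finset.card_pos.2 ⟨x, by simp [hx]⟩
    rw [add_mul]
    omega

end FoldSum

/-- Hamidoune's isoperimetric theorem: the isoperimetric number of a proper subset `B` of a finite
abelian group is attained by a subgroup. -/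
lemma exists_addSubgroup_isoperimetric {G : Type*} [AddCommGroup G] [Fintype G] [DecidableEq G]
    {B : Finset G} (hB : B ≠ Finset.univ) :
    ∃ H : AddSubgroup G, ∃ X : Finset G, (∀ x, x ∈ X ↔ x ∈ H) ∧ X + B ≠ Finset.univ ∧
      ∀ Y : Finset G, Y.Nonempty → Y + B ≠ Finset.univ →
        Y.card + (X + B).card ≤ (Y + B).card + X.card := by
  classical
  let P : Finset (Finset G) := Finset.univ.filter fun X => X.Nonempty ∧ X + B ≠ Finset.univ
  have hP : ∀ X, X ∈ P ↔ X.Nonempty ∧ X + B ≠ Finset.univ := fun X => by simp [P]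
  let d : Finset G → ℤ := fun X => (X + B).card - X.card
  obtain ⟨X₀, hX₀, hmin⟩ := P.exists_min_image d ⟨{0}, by simpa [hP, Finset.singleton_add] using hB⟩
  obtain ⟨X₁, hX₁, hmin'⟩ := (P.filter fun X => d X = d X₀).exists_min_image Finset.card
    ⟨X₀, by simp [hX₀]⟩
  rw [Finset.mem_filter] at hX₁
  -- translates of minimisers are minimisers
  have htrans : ∀ (X : Finset G) (g : G), X ∈ P → g +ᵥ X ∈ P ∧ d (g +ᵥ X) = d X := by
    intro X g hX
    rw [hP] at hX
    have : (g +ᵥ X) + B = g +ᵥ (X + B) := vadd_add_assoc g X B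
    refine ⟨(hP _).2 ⟨hX.1.vadd_finset, ?_⟩, by simp [d, this]⟩
    rw [Ne, this, ← Finset.card_eq_iff_eq_univ, Finset.card_vadd_finset, Finset.card_eq_iff_eq_univ]
    exact hX.2
  obtain ⟨x₁, hx₁⟩ := ((hP _).1 hX₁.1).1
  let X := -x₁ +ᵥ X₁
  have h0X : (0 : G) ∈ X := Finset.mem_vadd_finset.2 ⟨x₁, hx₁, by simp⟩
  have hX := htrans X₁ (-x₁) hX₁.1
  have hXc : X.card = X₁.card := Finset.card_vadd_finset _ _
  have hmin1 : ∀ Y ∈ P, d X ≤ d Y := fun Y hY => by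
    have := hmin Y hY
    have := hX.2
    have := hX₁.2
    change d X = d X₁ at *
    omega
  have hmin2 : ∀ Y ∈ P, d Y ≤ d X → X.card ≤ Y.card := fun Y hY h => by
    rw [hXc]
    refine hmin' Y (Finset.mem_filter.2 ⟨hY, le_antisymm ?_ (hmin Y hY)⟩)
    have := hX.2
    have := hX₁.2
    change d X = d X₁ at *
    omega
  have hXP : X ∈ P := hX.1
  -- the complement of `X + B` gives a large dual minimiser
  have hdual : (X.card : ℤ) ≤ Fintype.card G - (X + B).card := by
    have hZc : ((-(X + B)ᶜ : Finset G).card : ℤ) = Fintype.card G - (X + B).card := by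
      rw [Finset.card_neg, Finset.card_compl, Nat.cast_sub (Finset.card_le_univ _)]
    have hsub : -(X + B)ᶜ + B ⊆ (-X)ᶜ := by
      intro z hz
      obtain ⟨u, hu, v, hv, rfl⟩ := Finset.mem_add.1 hz
      rw [Finset.mem_neg'] at hu
      rw [Finset.mem_compl] at *
      intro h
      rw [Finset.mem_neg'] at h
      exact hu (Finset.mem_add.2 ⟨_, h, v, hv, by abel⟩)
    have hcard := Finset.card_le_card hsub
    rw [Finset.card_compl, Finset.card_neg] at hcard
    have hXu := Finset.card_le_univ X
    rw [← hZc]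
    refine Nat.cast_le.2 (hmin2 _ ((hP _).2 ⟨?_, ?_⟩) ?_)
    · rw [Finset.neg_nonempty_iff, Finset.nonempty_iff_ne_empty, Ne, Finset.compl_eq_empty_iff]
      exact ((hP _).1 hXP).2
    · intro h
      have : (0 : G) ∈ (-X)ᶜ := hsub (h ▸ Finset.mem_univ _)
      simp [h0X] at this
    · simp only [d]
      rw [hZc]
      omega
  have hkey : ∀ x ∈ X, -x +ᵥ X = X := by
    intro x hx
    by_contra hne
    set X' := -x +ᵥ X
    obtain ⟨hX'P, hX'd⟩ := htrans X (-x) hXP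
    have hX'c : X'.card = X.card := Finset.card_vadd_finset _ _
    have h0X' : (0 : G) ∈ X' := Finset.mem_vadd_finset.2 ⟨x, hx, by simp⟩
    have hIlt : (X ∩ X').card < X.card := by
      refine Finset.card_lt_card (Finset.ssubset_iff_subset_ne.2 ⟨Finset.inter_subset_left, ?_⟩)
      intro h
      exact hne (Finset.eq_of_subset_of_card_le (Finset.inter_eq_left.1 h) hX'c.le).symm
    have hIsub : X ∩ X' + B ⊆ (X + B) ∩ (X' + B) := Finset.inter_add_subset
    have hIP : X ∩ X' ∈ P := by
      refine (hP _).2 ⟨⟨0, by simp [h0X, h0X']⟩, fun h => ((hP _).1 hXP).2 ?_⟩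
      rw [Finset.eq_univ_iff_forall] at h ⊢
      exact fun y => (Finset.mem_inter.1 (hIsub (h y))).1
    have hId : d X < d (X ∩ X') := by
      by_contra! h
      exact absurd (hmin2 _ hIP h) (by omega)
    have h1 := Finset.card_le_card hIsub
    have h2 := Finset.card_union_add_card_inter (X + B) (X' + B)
    have h3 := Finset.card_union_add_card_inter X X'
    rw [← Finset.union_add] at h2
    have hUd : d (X ∪ X') < d X := by
      change d X' = d X at hX'd
      simp only [d] at *
      omega
    have hUP : X ∪ X' ∉ P := fun h => absurd (hmin1 _ h) (by omega)
    rw [hP] at hUP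
    push Not at hUP
    have hU := hUP ⟨0, by simp [h0X]⟩
    have hpos : 0 < (X ∩ X').card := Finset.card_pos.2 ⟨0, by simp [h0X, h0X']⟩
    simp only [d, hU, Finset.card_univ] at hUd
    omega
  have hsubm : ∀ x ∈ X, ∀ y ∈ X, y - x ∈ X := fun x hx y hy => by
    rw [← hkey x hx]
    exact Finset.mem_vadd_finset.2 ⟨y, hy, by simp [sub_eq_neg_add]⟩
  have hneg : ∀ x ∈ X, -x ∈ X := fun x hx => by simpa using hsubm x hx 0 h0X
  refine ⟨{ carrier := X
            zero_mem' := h0X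
            add_mem' := fun {a b} ha hb => by
              simpa [add_comm] using hsubm (-a) (hneg a ha) b hb
            neg_mem' := fun {a} ha => hneg a ha }, X, fun x => Iff.rfl, ((hP _).1 hXP).2, ?_⟩
  intro Y hY hYB
  have := hmin1 Y ((hP _).2 ⟨hY, hYB⟩)
  simp only [d] at this
  omega

section Cosets

lemma card_filter_mem_of_card_fiber {G Q : Type*} [AddCommGroup G] [Fintype G]
    [AddCommGroup Q] [DecidableEq Q] {q : G →+ Q} {m : ℕ}
    (hm : ∀ c, (Finset.univ.filter fun x => q x = c).card = m) (T : Finset Q) :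
    (Finset.univ.filter fun x => q x ∈ T).card = m * T.card := by
  rw [Finset.card_eq_sum_card_fiberwise (f := q) (t := T) (fun x hx => by simpa using hx),
    Finset.sum_congr rfl (g := fun _ => m), Finset.sum_const, smul_eq_mul, mul_comm]
  intro c hc
  rw [← hm c, Finset.filter_filter]
  congr 1
  ext x
  simp only [Finset.mem_filter, Finset.mem_univ, true_and]
  exact ⟨fun h => h.2, fun h => ⟨h ▸ hc, h⟩⟩

variable {G Q : Type*} [AddCommGroup G] [Fintype G] [DecidableEq G]
  [AddCommGroup Q] [DecidableEq Q]

lemma filter_mem_add {q : G →+ Q} (T : Finset Q) (B : Finset G) :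
    (Finset.univ.filter fun x => q x ∈ T) + B =
      Finset.univ.filter fun x => q x ∈ T + B.image q := by
  ext x
  simp only [Finset.mem_add, Finset.mem_filter, Finset.mem_univ, true_and, Finset.mem_image]
  constructor
  · rintro ⟨y, hy, z, hz, rfl⟩
    exact ⟨q y, hy, q z, ⟨z, hz, rfl⟩, (map_add q y z).symm⟩
  · rintro ⟨y, hy, _, ⟨z, hz, rfl⟩, h⟩
    exact ⟨x - z, by rwa [map_sub, ← h, add_sub_cancel_right], z, hz, sub_add_cancel x z⟩

/-- If `B` fills the cosets it meets up to few elements, then a coset outside of the `n`-fold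
sumset receives so many representations that together with the other cosets met by the
`(n + 1)`-fold sumset they make up for the missing elements. -/
lemma exists_new_coset [Fintype Q] {q : G →+ Q} {B : Finset G}
    (h0 : 0 ∈ B) {m : ℕ} (hm : ∀ c, (Finset.univ.filter fun x => q x = c).card = m)
    (hiso : ∀ T : Finset Q, T.Nonempty → T + B.image q ≠ Finset.univ →
      T.card + (B.image q).card ≤ (T + B.image q).card + 1)
    (hb : 2 ≤ (B.image q).card) (hBm : m * (B.image q).card + 2 ≤ B.card + m)
    {n : ℕ} (hn : 1 ≤ n) (hne : foldSum (n + 1) B ≠ Finset.univ) :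
    ∃ B' ⊆ B, ∃ s : ℕ, ∃ c : Q, (∀ x ∈ B', s ≤ (B'.filter fun y => q y = q x).card) ∧
      c ∈ foldSum (n + 1) (B'.image q) ∧ c ∉ foldSum n (B.image q) ∧
      (n + 1) * B.card ≤ (n + 1) * s + ((foldSum (n + 1) B).filter fun x => q x ≠ c).card := by
  set b := (B.image q).card with hbdef
  let β : Q → ℕ := fun c => (B.filter fun x => q x = c).card
  have h0q : (0 : Q) ∈ B.image q := Finset.mem_image.2 ⟨0, h0, map_zero q⟩
  have hβm : ∀ c, β c ≤ m := fun c => by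
    rw [← hm c]
    exact Finset.card_le_card (Finset.filter_subset_filter _ (Finset.subset_univ _))
  have hsum : ∀ S ⊆ B.image q, B.card + m * S.card ≤ ∑ c ∈ S, β c + m * b := by
    intro S hS
    have h1 : B.card = ∑ c ∈ B.image q, β c := Finset.card_eq_sum_card_image q B
    rw [← Finset.sum_sdiff hS] at h1
    have h2 : ∑ c ∈ B.image q \ S, β c ≤ (B.image q \ S).card • m :=
      Finset.sum_le_card_nsmul _ _ _ fun c _ => hβm c
    rw [smul_eq_mul, Finset.card_sdiff_of_subset hS, mul_comm, Nat.mul_sub, ← hbdef] at h2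
    have h3 : m * S.card ≤ m * b := Nat.mul_le_mul_left m (Finset.card_le_card hS)
    omega
  have hone : ∀ c ∈ B.image q, B.card + m ≤ β c + m * b := fun c hc => by
    simpa using hsum {c} (by simpa using hc)
  have htwo : ∀ c ∈ B.image q, ∀ c' ∈ B.image q, c ≠ c' →
      B.card + 2 * m ≤ β c + β c' + m * b := fun c hc c' hc' hcc => by
    have := hsum {c, c'} (Finset.insert_subset hc (by simpa using hc'))
    rw [Finset.card_pair hcc, Finset.sum_pair hcc] at this
    linarith
  have hsparse : ∀ c ∈ B.image q, ∀ c' ∈ B.image q, 2 * β c ≤ m → 2 * β c' ≤ m → c = c' := by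
    intro c hc c' hc' h h'
    by_contra hcc
    have := htwo c hc c' hc' hcc
    omega
  -- the sum of two well filled cosets is full
  have hfull : ∀ x ∈ B.image q, ∀ x' ∈ B.image q, m < β x + β x' →
      ∀ g, q g = x + x' → g ∈ B + B := by
    intro x hx x' hx' hlt g hg
    have hnd : ¬ Disjoint (B.filter fun y => q y = x)
        ((B.filter fun y => q y = x').image fun y => g - y) := by
      intro hd
      have h1 := Finset.card_union_of_disjoint hd
      rw [Finset.card_image_of_injective _ sub_right_injective] at h1
      have h2 : ((B.filter fun y => q y = x) ∪
          ((B.filter fun y => q y = x').image fun y => g - y)).card ≤ m := by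
        rw [← hm x]
        refine Finset.card_le_card fun y hy => ?_
        simp only [Finset.mem_union, Finset.mem_filter, Finset.mem_image, Finset.mem_univ,
          true_and] at hy ⊢
        rcases hy with hy | ⟨z, hz, rfl⟩
        · exact hy.2
        · rw [map_sub, hg, hz.2, add_sub_cancel_right]
      change _ = β x + β x' at h1
      omega
    obtain ⟨y, hy, hy'⟩ := Finset.not_disjoint_iff.1 hnd
    obtain ⟨z, hz, rfl⟩ := Finset.mem_image.1 hy'
    exact Finset.mem_add.2 ⟨g - z, (Finset.mem_filter.1 hy).1, z, (Finset.mem_filter.1 hz).1,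
      sub_add_cancel g z⟩
  have hdec : ∀ g ∉ foldSum (n + 1) B, ∀ x ∈ B.image q, ∀ y ∈ foldSum n (B.image q),
      x + y = q g → 2 * β x ≤ m := by
    intro g hg x hx y hy hxy
    by_contra hlt
    obtain ⟨N, rfl⟩ : ∃ N, n = N + 1 := ⟨n - 1, by omega⟩
    obtain ⟨x', hx', y', hy', rfl⟩ := mem_foldSum_succ.1 hy
    rw [← image_foldSum] at hy'
    obtain ⟨z, hz, rfl⟩ := Finset.mem_image.1 hy'
    have hlt' : m < β x + β x' := by
      by_cases hxx : x = x'
      · subst hxx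
        omega
      · have := htwo x hx x' hx' hxx
        omega
    obtain ⟨u, hu, v, hv, huv⟩ := Finset.mem_add.1
      (hfull x hx x' hx' hlt' (g - z) (by rw [map_sub, ← hxy]; abel))
    refine hg (mem_foldSum_succ.2 ⟨u, hu, v + z, mem_foldSum_succ.2 ⟨v, hv, z, hz, rfl⟩, ?_⟩)
    rw [← add_assoc, huv, sub_add_cancel]
  obtain ⟨g₀, hg₀⟩ : ∃ g, g ∉ foldSum (n + 1) B := by
    by_contra! h
    exact hne (Finset.eq_univ_iff_forall.2 h)
  have hsucc : ∀ k, foldSum k (B.image q) + B.image q = foldSum (k + 1) (B.image q) := fun k => by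
    rw [foldSum, add_comm]
  have hE : foldSum n (B.image q) ≠ Finset.univ := by
    intro hE
    have hall : ∀ x ∈ B.image q, 2 * β x ≤ m := fun x hx =>
      hdec g₀ hg₀ x hx (q g₀ - x) (hE ▸ Finset.mem_univ _) (add_sub_cancel x _)
    obtain ⟨x, hx, y, hy, hxy⟩ := Finset.one_lt_card.1 hb
    exact hxy (hsparse x hx y hy (hall x hx) (hall y hy))
  have hgrow : ∀ k, foldSum k (B.image q) ≠ Finset.univ →
      k * b + 1 ≤ (foldSum k (B.image q)).card + k := by
    intro k
    induction k with
    | zero => simp [foldSum]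
    | succ k ih =>
      intro hk
      have hk' : foldSum k (B.image q) ≠ Finset.univ := fun h => hk
        (Finset.univ_subset_iff.1 (h ▸ foldSum_subset_succ k h0q))
      have h1 := ih hk'
      have h2 := hiso _ (foldSum_nonempty k ⟨0, h0q⟩) (by rwa [hsucc])
      rw [hsucc] at h2
      rw [add_mul]
      omega
  have hD : (n + 1) * b ≤ (foldSum (n + 1) (B.image q)).card + n := by
    by_cases hDu : foldSum (n + 1) (B.image q) = Finset.univ
    · obtain ⟨x, hx, y, hy, hxy⟩ := mem_foldSum_succ.1 (hDu ▸ Finset.mem_univ (q g₀))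
      have hxs := hdec g₀ hg₀ x hx y hy hxy
      have hdisj : Disjoint (((B.image q).erase x).image fun z => q g₀ - z)
          (foldSum n (B.image q)) := by
        rw [Finset.disjoint_left]
        intro z hz hz'
        obtain ⟨w, hw, rfl⟩ := Finset.mem_image.1 hz
        rw [Finset.mem_erase] at hw
        exact hw.1 (hsparse w hw.2 x hx (hdec g₀ hg₀ w hw.2 _ hz' (add_sub_cancel w _)) hxs)
      have h1 := Finset.card_le_univ ((((B.image q).erase x).image fun z => q g₀ - z) ∪
          (foldSum n (B.image q)))
      rw [Finset.card_union_of_disjoint hdisj, Finset.card_image_of_injective _ sub_right_injective,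
        Finset.card_erase_of_mem hx] at h1
      have h2 := hgrow n hE
      rw [hDu, Finset.card_univ, add_mul]
      omega
    · have := hgrow _ hDu
      omega
  obtain ⟨c₀, hc₀, hc₀'⟩ : ∃ c ∈ foldSum (n + 1) (B.image q), c ∉ foldSum n (B.image q) := by
    by_contra! h
    have h1 := hiso _ (foldSum_nonempty n ⟨0, h0q⟩)
      (by rw [hsucc]; exact fun h' => hE (Finset.univ_subset_iff.1 (h' ▸ h)))
    rw [hsucc] at h1
    have h2 := Finset.card_le_card h
    omega
  have hcount : ∀ (U : Finset Q), ∀ c ∉ U, (∀ g, q g ∈ U → g ∈ foldSum (n + 1) B) →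
      m * U.card ≤ ((foldSum (n + 1) B).filter fun x => q x ≠ c).card := by
    intro U c hc h
    rw [← card_filter_mem_of_card_fiber hm U]
    refine Finset.card_le_card fun g hg => ?_
    have hg' : q g ∈ U := by simpa using hg
    exact Finset.mem_filter.2 ⟨h g hg', fun h' => hc (h' ▸ hg')⟩
  -- the main case: every coset of the sumset other than a new one is full
  have hmain : ∀ c ∈ foldSum (n + 1) (B.image q), c ∉ foldSum n (B.image q) →
      (∀ g, q g ∈ foldSum (n + 1) (B.image q) → q g ≠ c → g ∈ foldSum (n + 1) B) →
      ∃ B' ⊆ B, ∃ s : ℕ, ∃ c : Q, (∀ x ∈ B', s ≤ (B'.filter fun y => q y = q x).card) ∧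
      c ∈ foldSum (n + 1) (B'.image q) ∧ c ∉ foldSum n (B.image q) ∧
      (n + 1) * B.card ≤
        (n + 1) * s + ((foldSum (n + 1) B).filter fun x => q x ≠ c).card := by
    intro c hc hc' h
    refine ⟨B, subset_rfl, B.card + m - m * b, c, fun x hx => ?_, hc, hc', ?_⟩
    · have := hone (q x) (Finset.mem_image_of_mem q hx)
      change _ ≤ β (q x)
      omega
    · have h1 := hcount _ c (Finset.notMem_erase c _) fun g hg =>
        h g (Finset.mem_of_mem_erase hg) (Finset.ne_of_mem_erase hg)
      rw [Finset.card_erase_of_mem hc] at h1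
      have hpos : 0 < (foldSum (n + 1) (B.image q)).card := Finset.card_pos.2 ⟨c, hc⟩
      refine le_trans ?_ (Nat.add_le_add_left h1 _)
      zify [show m * b ≤ B.card + m by omega, Nat.succ_le_of_lt hpos] at hD ⊢
      have hm0 : (0 : ℤ) ≤ m := by positivity
      nlinarith [mul_le_mul_of_nonneg_left hD hm0]
  by_cases hall : ∀ g, q g ∈ foldSum (n + 1) (B.image q) → g ∈ foldSum (n + 1) B
  · exact hmain c₀ hc₀ hc₀' fun g hg _ => hall g hg
  push Not at hall
  obtain ⟨g, hg, hg'⟩ := hall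
  obtain ⟨x, hx, y, hy, hxy⟩ := mem_foldSum_succ.1 hg
  have hxs := hdec g hg' x hx y hy hxy
  have hunique : ∀ g', q g' ∈ foldSum (n + 1) (B.image q) → g' ∉ foldSum (n + 1) B →
      q g' = (n + 1) • x := fun g' h h' =>
    eq_nsmul_of_forall_decomposition h fun z hz w hw hzw =>
      hsparse z hz x hx (hdec g' h' z hz w hw hzw) hxs
  by_cases hx0 : x = 0
  · subst hx0
    simp only [smul_zero] at hunique
    have hc₀0 : c₀ ≠ 0 := by
      rintro rfl
      refine hc₀' ?_
      clear * - h0q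
      induction n with
      | zero => simp [foldSum]
      | succ n ih => exact foldSum_subset_succ n h0q ih
    refine ⟨B.filter fun z => q z ≠ 0, Finset.filter_subset _ _,
      B.card + 2 * m - (β 0 + m * b), c₀, ?_, ?_, hc₀', ?_⟩
    · intro z hz
      rw [Finset.mem_filter] at hz
      have h1 := htwo (q z) (Finset.mem_image_of_mem q hz.1) 0 h0q hz.2
      have h2 : ((B.filter fun z => q z ≠ 0).filter fun w => q w = q z) =
          B.filter fun w => q w = q z := by
        ext w
        simp only [Finset.mem_filter]
        exact ⟨fun h => ⟨h.1.1, h.2⟩, fun h => ⟨⟨h.1, h.2 ▸ hz.2⟩, h.2⟩⟩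
      rw [h2]
      change _ ≤ β (q z)
      omega
    · have h1 := mem_foldSum_erase_zero hc₀ hc₀'
      have h2 : (B.image q).erase 0 = (B.filter fun z => q z ≠ 0).image q := by
        ext w
        simp only [Finset.mem_erase, Finset.mem_image, Finset.mem_filter]
        constructor
        · rintro ⟨hw, z, hz, rfl⟩
          exact ⟨z, ⟨hz, hw⟩, rfl⟩
        · rintro ⟨z, ⟨hz, hw⟩, rfl⟩
          exact ⟨hw, z, hz, rfl⟩
      rwa [h2] at h1
    · have hpred := Finset.pred_card_le_card_erase (a := 0)
        (s := (foldSum (n + 1) (B.image q)).erase c₀)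
      have h1 := hcount (((foldSum (n + 1) (B.image q)).erase c₀).erase 0)
        c₀ (by simp) fun g hg => by
          simp only [Finset.mem_erase] at hg
          by_contra h
          exact hg.1 (hunique g hg.2.2 h)
      rw [Finset.card_erase_of_mem hc₀] at hpred
      have hm1 := hβm 0
      have hn2 : 2 ≤ n + 1 := by omega
      have hm0 : (0 : ℤ) ≤ m := by positivity
      have h2 : m * ((foldSum (n + 1) (B.image q)).card - 2) ≤
          m * (((foldSum (n + 1) (B.image q)).erase c₀).erase 0).card :=
        Nat.mul_le_mul_left m (by omega)
      have h3 : 2 ≤ (foldSum (n + 1) (B.image q)).card := by nlinarith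
      refine le_trans ?_ (Nat.add_le_add_left (h2.trans h1) _)
      zify [show β 0 + m * b ≤ B.card + 2 * m by omega, h3] at hD hxs hn2 ⊢
      nlinarith [mul_le_mul_of_nonneg_left hD hm0,
        mul_le_mul_of_nonneg_right hn2 (show (0 : ℤ) ≤ m - β 0 by omega)]
  · refine hmain (q g) hg (fun h => hx0 ?_) fun g' hg1 hg2 => ?_
    · exact (hsparse 0 h0q x hx (hdec g hg' 0 h0q (q g) h (zero_add _)) hxs).symm
    · by_contra h
      exact hg2 ((hunique g' hg1 h).trans (hunique g hg hg').symm)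

end Cosets

/-- A Kneser type alternative for iterated sumsets of a generating set. -/
lemma foldSum_eq_univ_or_card_le_or_exists_coset {G : Type*} [AddCommGroup G] [Fintype G]
    [DecidableEq G] {B : Finset G} (h0 : 0 ∈ B)
    (hgen : ∀ H : AddSubgroup G, (∀ x ∈ B, x ∈ H) → H = ⊤) {n : ℕ} (hn : 1 ≤ n) :
    foldSum (n + 1) B = Finset.univ ∨ (n + 1) * B.card ≤ (foldSum (n + 1) B).card + n ∨
      ∃ (H : AddSubgroup G) (_ : DecidableEq (G ⧸ H)), ∃ B' ⊆ B, ∃ s : ℕ, ∃ c : G ⧸ H,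
        (∀ x ∈ B', s ≤ (B'.filter fun y =>
          QuotientAddGroup.mk' H y = QuotientAddGroup.mk' H x).card) ∧
        c ∈ foldSum (n + 1) (B'.image (QuotientAddGroup.mk' H)) ∧
        c ∉ foldSum n (B.image (QuotientAddGroup.mk' H)) ∧
        (n + 1) * B.card ≤ (n + 1) * s +
          ((foldSum (n + 1) B).filter fun x => QuotientAddGroup.mk' H x ≠ c).card := by
  classical
  by_cases hne : foldSum (n + 1) B = Finset.univ
  · exact Or.inl hne
  refine Or.inr ?_
  have hstep : ∀ k, foldSum (k + 1) B ≠ Finset.univ → foldSum k B ≠ Finset.univ := fun k hk h =>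
    hk (Finset.univ_subset_iff.1 (h ▸ foldSum_subset_succ k h0))
  have hsub : ∀ k, B ⊆ foldSum (k + 1) B := by
    intro k
    induction k with
    | zero => rw [zero_add, foldSum_one]
    | succ k ih => exact ih.trans (foldSum_subset_succ (k + 1) h0)
  have hB : B ≠ Finset.univ := fun h => hne (Finset.univ_subset_iff.1 (h ▸ hsub n))
  obtain ⟨H, X, hXH, hXB, hiso⟩ := exists_addSubgroup_isoperimetric hB
  let q := QuotientAddGroup.mk' H
  have hq : Function.Surjective q := QuotientAddGroup.mk'_surjective H
  have hX : X = Finset.univ.filter fun x => q x ∈ ({0} : Finset (G ⧸ H)) := by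
    ext x
    simp [hXH, q]
  have hm : ∀ c, (Finset.univ.filter fun x => q x = c).card = X.card := by
    intro c
    obtain ⟨g, rfl⟩ := hq c
    rw [← Finset.card_vadd_finset g X]
    congr 1
    ext x
    simp only [Finset.mem_filter, Finset.mem_univ, true_and, Finset.mem_vadd_finset, vadd_eq_add]
    constructor
    · intro h
      exact ⟨-g + x, (hXH _).2 (QuotientAddGroup.eq.1 h.symm), by abel⟩
    · rintro ⟨y, hy, rfl⟩
      exact (QuotientAddGroup.eq.2 (by simpa using (hXH _).1 hy)).symm
  have hcard := fun T : Finset (G ⧸ H) => card_filter_mem_of_card_fiber hm T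
  have hXBc : (X + B).card = X.card * (B.image q).card := by
    conv_lhs => rw [hX]
    rw [filter_mem_add, hcard]
    congr 2
    simp [Finset.singleton_add]
  have hXpos : 0 < X.card := Finset.card_pos.2 ⟨0, (hXH 0).2 H.zero_mem⟩
  by_cases hBm : X.card * (B.image q).card + 2 ≤ B.card + X.card
  · refine Or.inr ⟨H, inferInstance, exists_new_coset h0 hm ?_ ?_ hBm hn hne⟩
    · intro T hT hTB
      have h1 := hiso (Finset.univ.filter fun x => q x ∈ T) ?_ ?_
      · rw [filter_mem_add, hcard, hcard, hXBc] at h1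
        refine Nat.le_of_mul_le_mul_left ?_ hXpos
        linarith
      · obtain ⟨t, ht⟩ := hT
        obtain ⟨g, rfl⟩ := hq t
        exact ⟨g, by simpa using ht⟩
      · rw [filter_mem_add]
        contrapose! hTB
        rw [Finset.eq_univ_iff_forall] at hTB ⊢
        intro t
        obtain ⟨g, rfl⟩ := hq t
        simpa using hTB g
    · by_contra! hb
      have h0q : (0 : G ⧸ H) ∈ B.image q := Finset.mem_image.2 ⟨0, h0, map_zero q⟩
      have hH : H = ⊤ := hgen H fun x hx => by
        have := Finset.card_le_one.1 (Nat.le_of_lt_succ hb) _ (Finset.mem_image_of_mem q hx) _ h0q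
        simpa [q] using this
      refine hXB (Finset.univ_subset_iff.1 fun x _ => ?_)
      exact Finset.mem_add.2 ⟨x, (hXH x).2 (hH ▸ AddSubgroup.mem_top x), 0, h0, add_zero x⟩
  · refine Or.inl ?_
    have hgrow : ∀ k, foldSum k B ≠ Finset.univ → k * B.card + 1 ≤ (foldSum k B).card + k := by
      intro k
      induction k with
      | zero => simp [foldSum]
      | succ k ih =>
        intro hk
        have h1 := ih (hstep k hk)
        have h2 := hiso _ (foldSum_nonempty k ⟨0, h0⟩) (by rwa [add_comm])
        rw [hXBc, add_comm (foldSum k B)] at h2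
        rw [add_mul]
        change _ ≤ (B + foldSum k B).card + _
        omega
    have := hgrow _ hne
    omega

/-- **Lev's theorem** on the growth of the iterated sumsets of a finite set of integers. -/
lemma card_foldSum_add_min_le {A : Finset ℤ} {l : ℕ} (hl : 0 < l) (h0 : 0 ∈ A) (hlA : (l : ℤ) ∈ A)
    (hA : ∀ x ∈ A, 0 ≤ x ∧ x ≤ l) (hgcd : ∀ d : ℤ, (∀ x ∈ A, d ∣ x) → IsUnit d)
    {n : ℕ} (hn : 1 ≤ n) :
    (foldSum n A).card + min (l : ℤ) ((n + 1) * (A.card - 2) + 1) ≤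
      (foldSum (n + 1) A).card := by
  classical
  have : NeZero l := ⟨hl.ne'⟩
  let φ : ℤ →+ ZMod l := Int.castAddHom (ZMod l)
  set B := A.image φ with hBdef
  have h0B : (0 : ZMod l) ∈ B := Finset.mem_image.2 ⟨0, h0, map_zero φ⟩
  have hBc : A.card ≤ B.card + 1 := by
    rw [← Finset.card_erase_add_one hlA]
    refine Nat.add_le_add_right ?_ 1
    refine Finset.card_le_card_of_injOn φ ?_ ?_
    · intro x hx
      exact Finset.mem_coe.2 (Finset.mem_image_of_mem φ (Finset.mem_of_mem_erase hx))
    · intro x hx y hy hxy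
      rw [Finset.mem_coe, Finset.mem_erase] at hx hy
      have h1 := hA x hx.2
      have h2 := hA y hy.2
      have h3 : x % l = y % l := (ZMod.intCast_eq_intCast_iff' x y l).1 hxy
      rwa [Int.emod_eq_of_lt h1.1 (lt_of_le_of_ne h1.2 hx.1),
        Int.emod_eq_of_lt h2.1 (lt_of_le_of_ne h2.2 hy.1)] at h3
  have hgen : ∀ H : AddSubgroup (ZMod l), (∀ x ∈ B, x ∈ H) → H = ⊤ := by
    intro H hH
    obtain ⟨d, hd⟩ := Int.subgroup_cyclic (H.comap φ)
    rw [← AddSubgroup.zmultiples_eq_closure] at hd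
    have hu : IsUnit d := hgcd d fun x hx => by
      rw [← Int.mem_zmultiples_iff, ← hd]
      exact hH _ (Finset.mem_image_of_mem φ hx)
    rw [eq_top_iff]
    intro z _
    obtain ⟨y, rfl⟩ := ZMod.intCast_surjective z
    have : y ∈ H.comap φ := by
      rw [hd, Int.mem_zmultiples_iff]
      exact hu.dvd
    exact this
  set X := foldSum n A
  set Y := foldSum (n + 1) A
  have hXY : X ⊆ Y := foldSum_subset_succ n h0
  have hcard : (Y \ X).card + X.card = Y.card := Finset.card_sdiff_add_card_eq_card hXY
  -- every residue class gains an element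
  have himage : (Y \ X).image φ = foldSum (n + 1) B := by
    rw [hBdef, ← image_foldSum]
    refine subset_antisymm (Finset.image_subset_image Finset.sdiff_subset) fun z hz => ?_
    obtain ⟨y, hy, rfl⟩ := Finset.mem_image.1 hz
    obtain ⟨w, hw, hmax⟩ := (Y.filter fun x => φ x = φ y).exists_max_image id
      ⟨y, Finset.mem_filter.2 ⟨hy, rfl⟩⟩
    rw [Finset.mem_filter] at hw
    refine Finset.mem_image.2 ⟨w, Finset.mem_sdiff.2 ⟨hw.1, fun hwX => ?_⟩, hw.2⟩
    have := hmax (l + w) (Finset.mem_filter.2 ⟨mem_foldSum_succ.2 ⟨l, hlA, w, hwX, rfl⟩, by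
      rw [map_add, hw.2]
      simp [φ]⟩)
    simp only [id] at this
    omega
  suffices h : min (l : ℤ) ((n + 1) * (A.card - 2) + 1) ≤ (Y \ X).card by
    rw [← hcard]
    push_cast
    linarith
  have hle : (foldSum (n + 1) B).card ≤ (Y \ X).card := himage ▸ Finset.card_image_le
  have hn0 : (0 : ℤ) ≤ n + 1 := by positivity
  have hBc' : (A.card : ℤ) ≤ B.card + 1 := by exact_mod_cast hBc
  have hmul := mul_le_mul_of_nonneg_left hBc' hn0
  obtain h | h | ⟨H, _, B', hB', s, c, hs, hc, hc', h⟩ :=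
    foldSum_eq_univ_or_card_le_or_exists_coset h0B hgen hn
  · refine (min_le_left _ _).trans ?_
    rw [h, Finset.card_univ, ZMod.card] at hle
    exact_mod_cast hle
  · refine (min_le_right _ _).trans ?_
    zify at h hle
    linarith
  · refine (min_le_right _ _).trans ?_
    let q := QuotientAddGroup.mk' H
    let A' := A.filter fun x => φ x ∈ B'
    have hA'B : A'.image φ = B' := by
      ext z
      simp only [A', Finset.mem_image, Finset.mem_filter]
      constructor
      · rintro ⟨x, hx, rfl⟩
        exact hx.2
      · intro hz
        obtain ⟨x, hx, rfl⟩ := Finset.mem_image.1 (hB' hz)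
        exact ⟨x, ⟨hx, hz⟩, rfl⟩
    have hA'q : A'.image (q.comp φ) = B'.image q := by
      rw [← hA'B, Finset.image_image]
      rfl
    have h1 := le_card_filter_foldSum (q.comp φ) (X := A') (s := s) (n := n + 1) (c := c)
      (fun x hx => by
        refine (hs (φ x) (Finset.mem_filter.1 hx).2).trans ?_
        rw [← hA'B, Finset.filter_image]
        exact Finset.card_image_le)
      (by rwa [hA'q])
    have h2 : (foldSum (n + 1) A').filter (fun x => q.comp φ x = c) ⊆
        (Y \ X).filter fun x => q.comp φ x = c := by
      intro x hx
      rw [Finset.mem_filter] at hx ⊢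
      refine ⟨Finset.mem_sdiff.2 ⟨foldSum_mono _ (Finset.filter_subset _ _) hx.1, fun hxX => ?_⟩,
        hx.2⟩
      refine hc' ?_
      rw [hBdef, ← image_foldSum, ← image_foldSum, ← hx.2]
      exact Finset.mem_image_of_mem q (Finset.mem_image_of_mem φ hxX)
    have h3 : ((foldSum (n + 1) B).filter fun x => q x ≠ c).card ≤
        ((Y \ X).filter fun x => ¬ q.comp φ x = c).card := by
      rw [← himage, Finset.filter_image]
      exact Finset.card_image_le
    have h4 := Finset.card_le_card h2
    have h5 := Finset.card_filter_add_card_filter_not (s := Y \ X) (fun x => q.comp φ x = c)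
    change _ ≤ _ + ((foldSum (n + 1) B).filter fun x => q x ≠ c).card at h
    zify at h h1 h3 h4 h5
    linarith

section SubsequenceSums

variable {k : ℕ} {a : ℕ → ℤ} {r : ℕ → ℕ}

lemma sum_mem_SeqSub {c : ℕ → ℕ} (hc : ∀ i ∈ Finset.Icc 1 k, c i ≤ r i)
    (h0 : ∑ i ∈ Finset.Icc 1 k, (c i : ℤ) * a i ≠ 0) :
    ∑ i ∈ Finset.Icc 1 k, (c i : ℤ) * a i ∈
      SeqSub (∑ i ∈ Finset.Icc 1 k, Multiset.replicate (r i) (a i)) := by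
  have hsum : (∑ i ∈ Finset.Icc 1 k, Multiset.replicate (c i) (a i)).sum =
      ∑ i ∈ Finset.Icc 1 k, (c i : ℤ) * a i := by
    simp [Multiset.sum_sum]
  rw [SeqSub, Multiset.mem_toFinset, Multiset.mem_map]
  refine ⟨∑ i ∈ Finset.Icc 1 k, Multiset.replicate (c i) (a i), ?_, hsum⟩
  rw [Multiset.mem_filter, Multiset.mem_powerset]
  refine ⟨Finset.sum_le_sum fun i hi => Multiset.replicate_mono _ (hc i hi), fun h => h0 ?_⟩
  rw [← hsum, h, Multiset.sum_zero]

/-- Elements of an iterated sumset of `A ∪ {0}` are bounded combinations of the elements. -/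
lemma exists_coeff_of_mem_foldSum {n : ℕ} {x : ℤ}
    (hx : x ∈ foldSum n (insert 0 ((Finset.Icc 1 k).image a))) :
    ∃ c : ℕ → ℕ, (∀ i, c i ≤ n) ∧ ∑ i ∈ Finset.Icc 1 k, (c i : ℤ) * a i = x := by
  induction n generalizing x with
  | zero =>
    simp only [foldSum, Finset.mem_singleton] at hx
    exact ⟨fun _ => 0, by simp, by simp [hx]⟩
  | succ n ih =>
    obtain ⟨u, hu, y, hy, rfl⟩ := mem_foldSum_succ.1 hx
    obtain ⟨c, hc, rfl⟩ := ih hy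
    rw [Finset.mem_insert, Finset.mem_image] at hu
    obtain rfl | ⟨j, hj, rfl⟩ := hu
    · exact ⟨c, fun i => (hc i).trans n.le_succ, (zero_add _).symm⟩
    · refine ⟨fun i => c i + if i = j then 1 else 0, fun i => ?_, ?_⟩
      · have := hc i
        dsimp only
        split_ifs <;> omega
      · simp [add_mul, Finset.sum_add_distrib, hj, -Finset.mem_Icc, add_comm]

/-- The sums above a given one: the sums of a strictly increasing chain. -/
lemma exists_finset_sums_above (ha : ∀ i j, 1 ≤ i → i < j → j ≤ k → a i < a j)
    (hpos : ∀ i, 1 ≤ i → i ≤ k → 0 < a i) (hr : ∀ i, 1 ≤ i → i ≤ k → 1 ≤ r i)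
    {d : ℕ} {c : ℕ → ℕ} (hc : ∀ i ∈ Finset.Icc 1 k, c i ≤ r i)
    (hd : ∑ i ∈ Finset.Icc 1 k, (c i : ℤ) * i + d = ∑ i ∈ Finset.Icc 1 k, (r i : ℤ) * i) :
    ∃ S : Finset ℤ, S.card = d ∧ (∀ x ∈ S, ∑ i ∈ Finset.Icc 1 k, (c i : ℤ) * a i < x) ∧
      ∀ x ∈ S, ∃ c' : ℕ → ℕ, (∀ i ∈ Finset.Icc 1 k, c' i ≤ r i) ∧
        ∑ i ∈ Finset.Icc 1 k, (c' i : ℤ) * a i = x := by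
  induction d generalizing c with
  | zero => exact ⟨∅, by simp⟩
  | succ d ih =>
    have hex : ∃ i, i ∈ Finset.Icc 1 k ∧ c i < r i := by
      by_contra! h
      have : ∑ i ∈ Finset.Icc 1 k, (r i : ℤ) * i ≤ ∑ i ∈ Finset.Icc 1 k, (c i : ℤ) * i :=
        Finset.sum_le_sum fun i hi =>
          mul_le_mul_of_nonneg_right (by exact_mod_cast h i hi) (by positivity)
      push_cast at hd
      linarith
    classical
    obtain ⟨hi, hlt⟩ := Nat.find_spec hex
    have hmin := fun j => Nat.find_min hex (m := j)
    set i := Nat.find hex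
    rw [Finset.mem_Icc] at hi
    have hprev : i - 1 ∈ Finset.Icc 1 k → r (i - 1) ≤ c (i - 1) := fun h => by
      have := hmin (i - 1) (by omega)
      push Not at this
      exact this h
    let c' : ℕ → ℕ := fun j => if j = i then c j + 1 else if j = i - 1 then c j - 1 else c j
    have hc' : ∀ j ∈ Finset.Icc 1 k,
        (c' j : ℤ) = c j + (if j = i then 1 else 0) - (if j = i - 1 then 1 else 0) := by
      intro j hj
      by_cases h1 : j = i
      · have : j ≠ i - 1 := by omega
        simp only [c', if_pos h1, if_neg this]
        push_cast
        ring
      by_cases h2 : j = i - 1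
      · subst h2
        have h3 := hprev hj
        rw [Finset.mem_Icc] at hj
        have h4 := hr (i - 1) hj.1 hj.2
        simp only [c', if_neg h1, if_true]
        omega
      · simp [c', h1, h2]
    have hsum : ∀ w : ℕ → ℤ, ∑ j ∈ Finset.Icc 1 k, (c' j : ℤ) * w j =
        ∑ j ∈ Finset.Icc 1 k, (c j : ℤ) * w j + w i -
          if i - 1 ∈ Finset.Icc 1 k then w (i - 1) else 0 := by
      intro w
      rw [Finset.sum_congr rfl fun j hj => by rw [hc' j hj]]
      simp [sub_mul, add_mul, Finset.sum_add_distrib, Finset.sum_sub_distrib, hi.1, hi.2]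
    have hlt' : ∑ j ∈ Finset.Icc 1 k, (c j : ℤ) * a j <
        ∑ j ∈ Finset.Icc 1 k, (c' j : ℤ) * a j := by
      rw [hsum]
      split_ifs with h
      · have := ha (i - 1) i (Finset.mem_Icc.1 h).1 (by omega) hi.2
        linarith
      · have := hpos i hi.1 hi.2
        linarith
    have hc'r : ∀ j ∈ Finset.Icc 1 k, c' j ≤ r j := by
      intro j hj
      have := hc j hj
      by_cases h1 : j = i
      · subst h1
        simp only [c', if_true]
        omega
      · simp only [c', if_neg h1]
        split_ifs <;> omega
    obtain ⟨S, hS, hSlt, hSc⟩ := ih hc'r (by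
      rw [hsum, ← hd]
      split_ifs with h
      · rw [Nat.cast_sub hi.1]
        push_cast
        ring
      · have : i = 1 := by
          rw [Finset.mem_Icc] at h
          omega
        rw [this]
        push_cast
        ring)
    refine ⟨insert (∑ j ∈ Finset.Icc 1 k, (c' j : ℤ) * a j) S, ?_, ?_, ?_⟩
    · rw [Finset.card_insert_of_notMem fun h => (hSlt _ h).false, hS]
    · intro x hx
      obtain rfl | hx := Finset.mem_insert.1 hx
      · exact hlt'
      · exact hlt'.trans (hSlt x hx)
    · intro x hx
      obtain rfl | hx := Finset.mem_insert.1 hx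
      · exact ⟨c', hc'r, rfl⟩
      · exact hSc x hx

end SubsequenceSums

lemma foldSum_bounds {X : Finset ℤ} {l : ℤ} (hX : ∀ x ∈ X, 0 ≤ x ∧ x ≤ l) {n : ℕ} {x : ℤ}
    (hx : x ∈ foldSum n X) : 0 ≤ x ∧ x ≤ n * l := by
  induction n generalizing x with
  | zero =>
    simp only [foldSum, Finset.mem_singleton] at hx
    simp [hx]
  | succ n ih =>
    obtain ⟨u, hu, y, hy, rfl⟩ := mem_foldSum_succ.1 hx
    have h1 := hX u hu
    have h2 := ih hy
    push_cast
    constructor <;> linarith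

theorem freiman_subsequence_sum_high_multiplicity (k : ℕ) (hk : 1 ≤ k) (a : ℕ → ℤ) (r : ℕ → ℕ)
    (ha : ∀ i j, 1 ≤ i → i < j → j ≤ k → a i < a j)
    (hpos : ∀ i, 1 ≤ i → i ≤ k → 0 < a i)
    (hr : ∀ i, 1 ≤ i → i ≤ k → 2 ≤ r i)
    (hgcd : (Finset.Icc 1 k).gcd a = 1)
    (rr : ℕ) (hrr : rr = (Finset.Icc 1 k).inf' (Finset.nonempty_Icc.mpr hk) r) :
    ((hfold (rr - 1) (insert 0 ((Finset.Icc 1 k).image a))).card : ℤ)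
      + min (a k) ((rr : ℤ) * ((k : ℤ) - 1) + 1) - 1
      + ∑ i ∈ Finset.Icc 1 (k - 1), (i : ℤ) * (r i : ℤ)
      + (k : ℤ) * ((r k : ℤ) - (rr : ℤ))
      ≤ ((SeqSub (∑ i ∈ Finset.Icc 1 k, Multiset.replicate (r i) (a i))).card : ℤ) := by
  have hrr2 : 2 ≤ rr := hrr ▸ (Finset.le_inf'_iff _ _).2 fun i hi =>
    hr i (Finset.mem_Icc.1 hi).1 (Finset.mem_Icc.1 hi).2
  have hrle : ∀ i ∈ Finset.Icc 1 k, rr ≤ r i := fun i hi => hrr ▸ Finset.inf'_le r hi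
  have hkk : k ∈ Finset.Icc 1 k := Finset.mem_Icc.2 ⟨hk, le_rfl⟩
  have hak := hpos k hk le_rfl
  set A : Finset ℤ := insert 0 ((Finset.Icc 1 k).image a) with hAdef
  have hA : ∀ x ∈ A, 0 ≤ x ∧ x ≤ a k := by
    intro x hx
    obtain rfl | hx := Finset.mem_insert.1 hx
    · exact ⟨le_rfl, hak.le⟩
    · obtain ⟨i, hi, rfl⟩ := Finset.mem_image.1 hx
      rw [Finset.mem_Icc] at hi
      refine ⟨(hpos i hi.1 hi.2).le, ?_⟩
      obtain rfl | hlt := hi.2.eq_or_lt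
      · exact le_rfl
      · exact (ha i k hi.1 hlt le_rfl).le
  have hAcard : A.card = k + 1 := by
    rw [hAdef, Finset.card_insert_of_notMem, Finset.card_image_of_injOn, Nat.card_Icc]
    · omega
    · intro i hi j hj hij
      rw [Finset.mem_coe, Finset.mem_Icc] at hi hj
      rcases lt_trichotomy i j with h | h | h
      · exact absurd hij (ha i j hi.1 h hj.2).ne
      · exact h
      · exact absurd hij (ha j i hj.1 h hi.2).ne'
    · intro h
      obtain ⟨i, hi, hi0⟩ := Finset.mem_image.1 h
      rw [Finset.mem_Icc] at hi
      exact (hpos i hi.1 hi.2).ne' hi0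
  have hlev : (hfold (rr - 1) A).card + min (a k) ((rr : ℤ) * ((k : ℤ) - 1) + 1) ≤
      (foldSum rr A).card := by
    obtain ⟨n, rfl⟩ : ∃ n, rr = n + 1 := ⟨rr - 1, by omega⟩
    lift a k to ℕ using hak.le with l hl
    have h := card_foldSum_add_min_le (A := A) (l := l) (by exact_mod_cast hak)
      (Finset.mem_insert_self _ _)
      (hl ▸ Finset.mem_insert_of_mem (Finset.mem_image_of_mem a hkk)) hA
      (fun d hd => by
        rw [isUnit_iff_dvd_one, ← hgcd]
        exact Finset.dvd_gcd fun i hi =>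
          hd _ (Finset.mem_insert_of_mem (Finset.mem_image_of_mem a hi)))
      (n := n) (by omega)
    rw [hAcard] at h
    rw [hfold_eq_foldSum, Nat.add_sub_cancel]
    convert h using 4
    · push_cast
      ring
  have hsplit : ∑ i ∈ Finset.Icc 1 k, (r i : ℤ) * i =
      ∑ i ∈ Finset.Icc 1 (k - 1), (i : ℤ) * (r i : ℤ) + k * r k := by
    obtain ⟨j, rfl⟩ : ∃ j, k = j + 1 := ⟨k - 1, by omega⟩
    rw [Finset.sum_Icc_succ_top hk, Nat.add_sub_cancel, mul_comm ((j + 1 : ℕ) : ℤ)]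
    congr 1
    exact Finset.sum_congr rfl fun i _ => mul_comm _ _
  let c : ℕ → ℕ := fun i => if i = k then rr else 0
  have hcsum : ∀ w : ℕ → ℤ, ∑ i ∈ Finset.Icc 1 k, (c i : ℤ) * w i = rr * w k := fun w => by
    simp [c, hk]
  have hcr : ∀ i ∈ Finset.Icc 1 k, c i ≤ r i := fun i hi => by
    have := hrle i hi
    simp only [c]
    split_ifs <;> omega
  have hle : ∑ i ∈ Finset.Icc 1 k, (c i : ℤ) * i ≤ ∑ i ∈ Finset.Icc 1 k, (r i : ℤ) * i :=
    Finset.sum_le_sum fun i hi =>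
      mul_le_mul_of_nonneg_right (by exact_mod_cast hcr i hi) (by positivity)
  obtain ⟨d, hd⟩ := Int.le.dest hle
  obtain ⟨S, hScard, hSlt, hSc⟩ := exists_finset_sums_above ha hpos
    (fun i h h' => one_le_two.trans (hr i h h')) hcr hd
  rw [hcsum] at hd hSlt
  have hdisj : Disjoint ((foldSum rr A).erase 0) S := by
    rw [Finset.disjoint_left]
    intro x hx hxS
    exact absurd (hSlt x hxS) (foldSum_bounds hA (Finset.mem_of_mem_erase hx)).2.not_gt
  have hsub : (foldSum rr A).erase 0 ∪ S ⊆
      SeqSub (∑ i ∈ Finset.Icc 1 k, Multiset.replicate (r i) (a i)) := by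
    intro x hx
    rw [Finset.mem_union] at hx
    obtain ⟨hx0, c', hc', rfl⟩ : x ≠ 0 ∧ ∃ c' : ℕ → ℕ, (∀ i ∈ Finset.Icc 1 k, c' i ≤ r i) ∧
        ∑ i ∈ Finset.Icc 1 k, (c' i : ℤ) * a i = x := by
      obtain hx | hx := hx
      · obtain ⟨c', hc', h⟩ := exists_coeff_of_mem_foldSum (Finset.mem_of_mem_erase hx)
        exact ⟨Finset.ne_of_mem_erase hx, c', fun i hi => (hc' i).trans (hrle i hi), h⟩
      · refine ⟨ne_of_gt (lt_of_le_of_lt ?_ (hSlt x hx)), hSc x hx⟩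
        positivity
    exact sum_mem_SeqSub hc' hx0
  have hcard := Finset.card_le_card hsub
  rw [Finset.card_union_of_disjoint hdisj, hScard] at hcard
  have hpred := Finset.pred_card_le_card_erase (a := 0) (s := foldSum rr A)
  have hcard' : ((foldSum rr A).card : ℤ) + d ≤
      (SeqSub (∑ i ∈ Finset.Icc 1 k, Multiset.replicate (r i) (a i))).card + 1 := by
    omega
  rw [hsplit] at hd
  linarith
end

section
/- Let k ≥ 3, α ≤ k - 2 a positive integer, and A = {a_1 < ... < a_k} a set of k positive integers with gcd(A) = 1. If a_k ≤ 2k - 3, then |S_α(A)| ≥ a_k + k(k-1)/2 - α(α+1)/2 + 1; if a_k ≥ 2k - 2, then |S_α(A)| ≥ θ(k+1) - 4 + k(k-1)/2 - α(α+1)/2 + 1, where θ = (1+√5)/2. -/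
open Pointwise

open Finset in
theorem card_add_card_le_card_add_add_card_filter_neg {G : Type*} [AddCommGroup G] [DecidableEq G]
    [Finite G] (A B : Finset G) (hA : 0 ∈ A) (hB : 0 ∈ B) :
    #A + #B ≤ #(A + B) + #(A.filter fun y => -y ∈ B) := by
  induction hn : #B using Nat.strong_induction_on generalizing A B with
  | _ n ih =>
  subst hn
  by_cases hstab : ∀ e ∈ A, ∀ b ∈ B, b + e ∈ A
  · have h1 : A ⊆ A + B := fun a ha => mem_add.2 ⟨a, ha, 0, hB, add_zero a⟩
    have hmul : ∀ b ∈ B, ∀ n : ℕ, n • b ∈ A := by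
      intro b hb n
      induction n with
      | zero => simpa using hA
      | succ n ihn => rw [succ_nsmul']; exact hstab _ ihn b hb
    have h2 : B.image (fun b => -b) ⊆ A.filter fun y => -y ∈ B := by
      intro y hy
      obtain ⟨b, hb, rfl⟩ := mem_image.1 hy
      refine mem_filter.2 ⟨?_, by simpa using hb⟩
      have hpos : 0 < addOrderOf b := addOrderOf_pos b
      have : (addOrderOf b - 1) • b + b = 0 := by
        rw [← succ_nsmul, Nat.sub_add_cancel hpos, addOrderOf_nsmul_eq_zero]
      rw [← eq_neg_of_add_eq_zero_left this]
      exact hmul b hb _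
    have h3 := card_le_card h2
    rw [card_image_of_injective _ neg_injective] at h3
    have := card_le_card h1
    omega
  · push Not at hstab
    obtain ⟨e, he, b₁, hb₁, hbe⟩ := hstab
    set S := B.image (· + e) with hS
    set A' := A ∪ S with hA'
    set B' := B.filter (· + e ∈ A) with hB'
    have hlt : #B' < #B := card_lt_card (filter_ssubset.2 ⟨b₁, hb₁, hbe⟩)
    have h := ih _ hlt A' B' (mem_union_left _ hA) (mem_filter.2 ⟨hB, by simpa using he⟩) rfl
    have hcard : #A' + #B' = #A + #B := by
      have h1 : #(A ∩ S) = #B' := by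
        rw [← card_image_of_injective B' (add_left_injective e)]
        congr 1
        ext x
        simp only [hS, hB', mem_inter, mem_image, mem_filter]
        constructor
        · rintro ⟨hx, b, hb, rfl⟩; exact ⟨b, ⟨hb, hx⟩, rfl⟩
        · rintro ⟨b, ⟨hb, hx⟩, rfl⟩; exact ⟨hx, b, hb, rfl⟩
      have h2 : #S = #B := card_image_of_injective B (add_left_injective e)
      have := card_union_add_card_inter A S
      rw [← hA'] at this
      omega
    have hsub : A' + B' ⊆ A + B := by
      intro x hx
      obtain ⟨a, ha, b, hb, rfl⟩ := mem_add.1 hx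
      obtain ⟨hb, hbA⟩ := mem_filter.1 hb
      rcases mem_union.1 ha with ha | ha
      · exact add_mem_add ha hb
      · obtain ⟨c, hc, rfl⟩ := mem_image.1 ha
        exact mem_add.2 ⟨_, hbA, c, hc, by abel⟩
    have hreps : #(A'.filter fun y => -y ∈ B') ≤ #(A.filter fun y => -y ∈ B) := by
      refine card_le_card_of_injOn (fun y => if y ∈ A then y else e - y) ?_ ?_
      · intro y hy
        simp only [coe_filter, Set.mem_ofPred_eq, hA', hB', mem_filter, mem_union] at hy
        obtain ⟨hy1, hy2, hy3⟩ := hy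
        simp only [coe_filter, Set.mem_ofPred_eq]
        by_cases hyA : y ∈ A
        · simp [hyA, hy2]
        · obtain ⟨b, hb, rfl⟩ := mem_image.1 (hy1.resolve_left hyA)
          simp only [hyA, if_false]
          refine ⟨?_, ?_⟩
          · convert hy3 using 1; abel
          · convert hb using 1; abel
      · intro y hy z hz hyz
        simp only [coe_filter, Set.mem_ofPred_eq, hB', mem_filter] at hy hz
        have h1 : -y + e = e - y := by abel
        have h2 : -z + e = e - z := by abel
        rw [h1] at hy
        rw [h2] at hz
        by_cases hyA : y ∈ A <;> by_cases hzA : z ∈ A <;> simp only [hyA, hzA, if_true, if_false] at hyz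
        · exact hyz
        · exact absurd (by rw [hyz, sub_sub_cancel] at hy; exact hy.2.2) hzA
        · exact absurd (by rw [← hyz, sub_sub_cancel] at hz; exact hz.2.2) hyA
        · exact sub_right_injective hyz
    have := card_le_card hsub
    omega

open Finset in
/-- Kemperman–Scherk bound. -/
theorem card_add_card_le_card_add_add_card_reps {G : Type*} [AddCommGroup G] [DecidableEq G]
    [Finite G] (A B : Finset G) {c : G} (hc : c ∈ A + B) :
    #A + #B ≤ #(A + B) + #(A.filter fun y => c - y ∈ B) := by
  obtain ⟨a, ha, b, hb, rfl⟩ := mem_add.1 hc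
  have h := card_add_card_le_card_add_add_card_filter_neg (A.image (· - a)) (B.image (· - b))
    (mem_image.2 ⟨a, ha, sub_self a⟩) (mem_image.2 ⟨b, hb, sub_self b⟩)
  rw [card_image_of_injective _ (sub_left_injective), card_image_of_injective _ (sub_left_injective)] at h
  have h1 : A.image (· - a) + B.image (· - b) = (A + B).image (· - (a + b)) := by
    ext x
    simp only [mem_add, mem_image]
    constructor
    · rintro ⟨_, ⟨y, hy, rfl⟩, _, ⟨z, hz, rfl⟩, rfl⟩
      exact ⟨y + z, ⟨y, hy, z, hz, rfl⟩, by abel⟩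
    · rintro ⟨_, ⟨y, hy, z, hz, rfl⟩, rfl⟩
      exact ⟨_, ⟨y, hy, rfl⟩, _, ⟨z, hz, rfl⟩, by abel⟩
  have h2 : (A.image (· - a)).filter (fun y => -y ∈ B.image (· - b)) =
      (A.filter fun y => a + b - y ∈ B).image (· - a) := by
    ext x
    simp only [mem_filter, mem_image]
    constructor
    · rintro ⟨⟨y, hy, rfl⟩, z, hz, hzy⟩
      refine ⟨y, ⟨hy, ?_⟩, rfl⟩
      have : a + b - y = z := by
        have : z = -(y - a) + b := by rw [← hzy]; abel
        rw [this]; abel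
      rwa [this]
    · rintro ⟨y, ⟨hy, hz⟩, rfl⟩
      exact ⟨⟨y, hy, rfl⟩, _, hz, by abel⟩
  rw [h1, h2, card_image_of_injective _ (sub_left_injective),
    card_image_of_injective _ (sub_left_injective)] at h
  exact h

open Finset in
/-- Isoperimetric method: among the sets `X` with `X + A` not everything, `|X + A| - |X|`
is minimised by a subgroup. -/
theorem exists_subgroup_card_add_le {G : Type*} [AddCommGroup G] [DecidableEq G]
    [Fintype G] (A X₀ : Finset G) (hX₀ : X₀.Nonempty) (hX₀A : X₀ + A ≠ univ) :
    ∃ H : AddSubgroup G, ∃ K : Finset G, (∀ x, x ∈ K ↔ x ∈ H) ∧ K + A ≠ univ ∧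
      #(K + A) + #X₀ ≤ #(X₀ + A) + #K := by
  set good : Finset (Finset G) := univ.filter fun X => X.Nonempty ∧ X + A ≠ univ with hgood
  have mem_good : ∀ X, X ∈ good ↔ X.Nonempty ∧ X + A ≠ univ := fun X => by simp [hgood]
  set f : Finset G → ℤ := fun X => #(X + A) - #X with hf
  obtain ⟨X₁, hX₁, hmin₁⟩ := exists_min_image good f ⟨X₀, (mem_good _).2 ⟨hX₀, hX₀A⟩⟩
  obtain ⟨M, hM, hminM⟩ := exists_min_image (good.filter fun X => f X = f X₁) card
    ⟨X₁, mem_filter.2 ⟨hX₁, rfl⟩⟩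
  obtain ⟨hMg, hMf⟩ := mem_filter.1 hM
  obtain ⟨hMne, hMA⟩ := (mem_good _).1 hMg
  have hmin : ∀ X, X.Nonempty → X + A ≠ univ → f M ≤ f X := fun X h1 h2 => by
    rw [hMf]; exact hmin₁ X ((mem_good _).2 ⟨h1, h2⟩)
  have hminc : ∀ X, X.Nonempty → X + A ≠ univ → f X = f M → #M ≤ #X := fun X h1 h2 h3 =>
    hminM X (mem_filter.2 ⟨(mem_good _).2 ⟨h1, h2⟩, by rw [h3, hMf]⟩)
  -- the complement of an atom is at least as large as the atom
  have hdual : #M + #(M + A) ≤ Fintype.card G := by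
    set Y := -(univ \ (M + A)) with hY
    have hYcard : #Y = Fintype.card G - #(M + A) := by
      rw [hY, card_neg, card_univ_sdiff]
    have hle : #(M + A) ≤ Fintype.card G := card_le_univ _
    have hYne : Y.Nonempty := by
      rw [hY, neg_nonempty_iff, sdiff_nonempty]
      exact fun h => hMA (univ_subset_iff.1 h)
    have hYM : Disjoint (Y + A) (-M) := by
      rw [disjoint_left]
      intro x hx hxM
      obtain ⟨y, hy, a, ha, rfl⟩ := mem_add.1 hx
      rw [hY, mem_neg'] at hy
      rw [mem_neg'] at hxM
      refine (mem_sdiff.1 hy).2 (mem_add.2 ⟨_, hxM, a, ha, by abel⟩)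
    have hYc : #(Y + A) + #M ≤ Fintype.card G := by
      rw [← card_neg M, ← card_union_of_disjoint hYM]
      exact card_le_univ _
    have hYA : Y + A ≠ univ := by
      intro h
      rw [h, card_univ] at hYc
      have := hMne.card_pos
      omega
    have h1 := hmin Y hYne hYA
    have h2 : f Y = f M := by
      refine le_antisymm ?_ h1
      simp only [hf]
      omega
    have := hminc Y hYne hYA h2
    omega
  -- translates of the atom which meet it coincide with it
  have htrans : ∀ N : Finset G, #N = #M → #(N + A) = #(M + A) → (M ∩ N).Nonempty → M = N := by
    intro N hNc hNA hne
    by_contra hMN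
    have hlt : #(M ∩ N) < #M := by
      refine card_lt_card (inter_subset_left.ssubset_of_ne fun h => hMN ?_)
      exact eq_of_subset_of_card_le (inter_eq_left.1 h) hNc.le
    have hIA : (M ∩ N) + A ≠ univ := fun h =>
      hMA (univ_subset_iff.1 (h ▸ add_subset_add_right inter_subset_left))
    have hI : f M + 1 ≤ f (M ∩ N) := by
      rcases (hmin _ hne hIA).lt_or_eq with h | h
      · omega
      · exact absurd (hminc _ hne hIA h.symm) (by omega)
    have hsubm : #((M ∪ N) + A) + #((M ∩ N) + A) ≤ #(M + A) + #(N + A) := by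
      rw [union_add, ← card_union_add_card_inter (M + A) (N + A)]
      exact Nat.add_le_add_left (card_le_card inter_add_subset) _
    have hun := card_union_add_card_inter M N
    have hpos := hne.card_pos
    simp only [hf] at hI
    have hUA : (M ∪ N) + A ≠ univ := by
      intro h
      rw [h, card_univ] at hsubm
      omega
    have := hmin _ (hMne.mono subset_union_left) hUA
    simp only [hf] at this
    omega
  obtain ⟨m, hm⟩ := hMne
  have hKcard : ∀ g : G, #(M.image (· + g)) = #M := fun g =>
    card_image_of_injective _ (add_left_injective g)
  have himg : ∀ g : G, M.image (· + g) + A = (M + A).image (· + g) := by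
    intro g
    ext x
    simp only [mem_add, mem_image]
    constructor
    · rintro ⟨_, ⟨y, hy, rfl⟩, z, hz, rfl⟩
      exact ⟨y + z, ⟨y, hy, z, hz, rfl⟩, by abel⟩
    · rintro ⟨_, ⟨y, hy, z, hz, rfl⟩, rfl⟩
      exact ⟨_, ⟨y, hy, rfl⟩, z, hz, by abel⟩
  have hKAcard : ∀ g : G, #(M.image (· + g) + A) = #(M + A) := fun g => by
    rw [himg, card_image_of_injective _ (add_left_injective g)]
  have hper : ∀ x ∈ M, ∀ y ∈ M, M.image (· + (x - y)) = M := by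
    intro x hx y hy
    refine (htrans _ (hKcard _) (hKAcard _) ⟨x, mem_inter.2 ⟨hx, mem_image.2 ⟨y, hy, ?_⟩⟩⟩).symm
    abel
  refine ⟨{ carrier := {g | g + m ∈ M}, zero_mem' := by simpa using hm, add_mem' := ?_, neg_mem' := ?_ },
    M.image (· + -m), ?_, ?_, ?_⟩
  · intro a b ha hb
    simp only [Set.mem_ofPred_eq] at *
    have := hper _ ha m hm
    rw [← this]
    exact mem_image.2 ⟨_, hb, by abel⟩
  · intro a ha
    simp only [Set.mem_ofPred_eq] at *
    have := hper m hm _ ha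
    rw [← this]
    exact mem_image.2 ⟨_, hm, by abel⟩
  · intro x
    rw [← AddSubgroup.mem_carrier]
    simp only [mem_image, Set.mem_ofPred_eq]
    constructor
    · rintro ⟨y, hy, rfl⟩; simpa using hy
    · intro h; exact ⟨_, h, by abel⟩
  · intro h
    apply hMA
    rw [← card_eq_iff_eq_univ, ← hKAcard (-m), h, card_univ]
  · rw [hKAcard, hKcard]
    have := hmin X₀ hX₀ hX₀A
    simp only [hf] at this
    omega

section RestrictedSums

open Finset

variable {G : Type*} [AddCommGroup G] [DecidableEq G]

theorem card_reps_add_card_le {A : Finset G} {τ a₀ a : G} (hτ₂ : τ + τ = 0)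
    (hτ : ∀ x : G, x + x = 0 → x = 0 ∨ x = τ)
    (h : ∀ b ∈ A, ∀ c ∈ A, b + c = a₀ + a₀ → b = c) :
    #(A.filter fun b => a₀ + a - b ∈ A) + #A ≤ #(A.image (a₀ + ·) ∪ A.image (a + ·)) + 2 ∧
    (¬ ((τ ≠ 0 ∧ a + τ ∈ A) ∧ (τ ≠ 0 ∧ a₀ + τ ∈ A)) →
      #(A.filter fun b => a₀ + a - b ∈ A) + #A ≤
        #(A.image (a₀ + ·) ∪ A.image (a + ·)) + 1) := by
  set Q := A.filter fun b => a₀ + a - b ∈ A with hQ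
  set P := A.filter fun b => b + a₀ - a ∈ A with hP
  have hPcard : #(A.image (a₀ + ·) ∩ A.image (a + ·)) = #P := by
    rw [← card_image_of_injective P (add_right_injective a₀)]
    congr 1
    ext x
    simp only [hP, mem_inter, mem_image, mem_filter]
    constructor
    · rintro ⟨⟨b, hb, rfl⟩, c, hc, hcb⟩
      refine ⟨b, ⟨hb, ?_⟩, rfl⟩
      rwa [add_comm, ← hcb, add_sub_cancel_left]
    · rintro ⟨b, ⟨hb, hc⟩, rfl⟩
      exact ⟨⟨b, hb, rfl⟩, _, hc, by abel⟩
  have h1 := card_union_add_card_inter (A.image (a₀ + ·)) (A.image (a + ·))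
  rw [card_image_of_injective A (add_right_injective a₀),
    card_image_of_injective A (add_right_injective a), hPcard] at h1
  have h2 := card_union_add_card_inter Q P
  have h3 : #(Q ∪ P) ≤ #A := card_le_card (union_subset (filter_subset _ _) (filter_subset _ _))
  have key : ∀ b ∈ Q ∩ P, b = a ∨ (b = a + τ ∧ (τ ≠ 0 ∧ a + τ ∈ A) ∧ (τ ≠ 0 ∧ a₀ + τ ∈ A)) := by
    intro b hb
    simp only [hQ, hP, mem_inter, mem_filter] at hb
    obtain ⟨⟨hbA, hxb⟩, -, hba⟩ := hb
    have e := h _ hxb _ hba (by abel)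
    have e2 : (b - a) + (b - a) = 0 := by
      have : (b - a) + (b - a) = (b + a₀ - a) - (a₀ + a - b) := by abel
      rw [this, e, sub_self]
    by_cases hba' : b = a
    · exact Or.inl hba'
    right
    rcases hτ _ e2 with h0 | h0
    · exact absurd (sub_eq_zero.1 h0) hba'
    have hb : b = a + τ := by rw [← h0]; abel
    have hτ0 : τ ≠ 0 := fun h => hba' (by rw [hb, h, add_zero])
    refine ⟨hb, ⟨hτ0, hb ▸ hbA⟩, hτ0, ?_⟩
    convert hxb using 1
    rw [hb, ← sub_eq_zero]
    rw [← hτ₂]; abel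
  constructor
  · have h4 : #(Q ∩ P) ≤ 2 := by
      refine (card_le_card (t := {a, a + τ}) fun b hb => ?_).trans card_le_two
      rcases key b hb with h | h <;> simp [h]
    omega
  · intro hn
    have h4 : #(Q ∩ P) ≤ 1 := by
      refine (card_le_card (t := {a}) fun b hb => ?_).trans (card_singleton a).le
      rcases key b hb with h | h
      · simp [h]
      · exact absurd h.2 hn
    omega

theorem translates_union_subset {A T : Finset G} {a₀ a : G}
    (hT : ∀ a ∈ A, ∀ b ∈ A, a ≠ b → a + b ∈ T) (ha₀ : a₀ ∈ A) (ha : a ∈ A) :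
    A.image (a₀ + ·) ∪ A.image (a + ·) ⊆ T ∪ (({a₀ + a₀, a + a} : Finset G) \ T) := by
  intro x hx
  simp only [mem_union, mem_image, mem_sdiff, mem_insert, mem_singleton] at hx ⊢
  by_cases hxT : x ∈ T
  · exact Or.inl hxT
  refine Or.inr ⟨?_, hxT⟩
  rcases hx with ⟨b, hb, rfl⟩ | ⟨b, hb, rfl⟩
  · left
    by_contra hne
    exact hxT (hT _ ha₀ _ hb fun h => hne (by rw [← h]))
  · right
    by_contra hne
    exact hxT (hT _ ha _ hb fun h => hne (by rw [← h]))

theorem card_reps_le_of_double_notMem {A T : Finset G} {τ a₀ a : G} (hτ₂ : τ + τ = 0)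
    (hτ : ∀ x : G, x + x = 0 → x = 0 ∨ x = τ)
    (hT : ∀ a ∈ A, ∀ b ∈ A, a ≠ b → a + b ∈ T) (ha₀ : a₀ ∈ A) (ha : a ∈ A)
    (ha₀T : a₀ + a₀ ∉ T)
    (hcond : ¬ ((τ ≠ 0 ∧ a + τ ∈ A) ∧ (τ ≠ 0 ∧ a₀ + τ ∈ A)) ∨
      ∃ f ∈ A, τ ≠ 0 ∧ f + τ ∈ A ∧ f + f ∉ T ∧ f + f ≠ a₀ + a₀ ∧ f + f ≠ a + a) :
    #(A.filter fun b => a₀ + a - b ∈ A) + #A ≤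
      #T + 1 + #(({a₀ + a₀, a + a} : Finset G) \ T) := by
  have huniq : ∀ b ∈ A, ∀ c ∈ A, b + c = a₀ + a₀ → b = c := by
    intro b hb c hc hbc
    by_contra hne
    exact ha₀T (hbc ▸ hT b hb c hc hne)
  obtain ⟨h2, h1⟩ := card_reps_add_card_le hτ₂ hτ huniq
  have hsub := translates_union_subset hT ha₀ ha
  set W := A.image (a₀ + ·) ∪ A.image (a + ·) with hW
  have hWle : #W ≤ #T + #(({a₀ + a₀, a + a} : Finset G) \ T) :=
    (card_le_card hsub).trans (card_union_le _ _)
  by_cases hp : (τ ≠ 0 ∧ a + τ ∈ A) ∧ (τ ≠ 0 ∧ a₀ + τ ∈ A)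
  · obtain ⟨f, hf, hτ0, hfτ, hfT, hf₀, hfa⟩ := hcond.resolve_left (not_not.2 hp)
    have hfT' : f + (f + τ) ∈ T := hT _ hf _ hfτ (by simpa using hτ0)
    have haux : ∀ c ∈ A, c + τ ∈ A → f + f ≠ c + c → f + (f + τ) ∉ A.image (c + ·) := by
      intro c hc hcτ hne hmem
      obtain ⟨b, hb, hbe⟩ := mem_image.1 hmem
      replace hbe : c + b = f + (f + τ) := hbe
      have e : f + f = (c + τ) + b := by
        have : f + f = f + (f + τ) + τ - (τ + τ) := by abel
        rw [this, ← hbe, hτ₂]; abel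
      have e2 : c + τ = b := by
        by_contra h
        exact hfT (e ▸ hT _ hcτ _ hb h)
      apply hne
      rw [e, ← e2]
      have : c + τ + (c + τ) = c + c + (τ + τ) := by abel
      rw [this, hτ₂, add_zero]
    have hfW : f + (f + τ) ∉ W := by
      rw [hW, mem_union, not_or]
      exact ⟨haux _ ha₀ hp.2.2 hf₀, haux _ ha hp.1.2 hfa⟩
    have hlt : #W < #T + #(({a₀ + a₀, a + a} : Finset G) \ T) :=
      (card_lt_card (Finset.ssubset_iff_of_subset hsub |>.2
        ⟨_, mem_union_left _ hfT', hfW⟩)).trans_le (card_union_le _ _)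
    omega
  · have := h1 hp
    omega

theorem sum_card_reps (A : Finset G) :
    ∑ x ∈ A + A, #(A.filter fun b => x - b ∈ A) = #A * #A := by
  simp only [card_filter]
  rw [sum_comm, ← smul_eq_mul, ← sum_const]
  refine sum_congr rfl fun b hb => ?_
  rw [← card_filter, ← card_image_of_injective A (add_left_injective b)]
  congr 1
  ext x
  simp only [mem_filter, mem_image]
  constructor
  · rintro ⟨-, h⟩; exact ⟨_, h, by abel⟩
  · rintro ⟨a, ha, rfl⟩
    exact ⟨add_mem_add ha hb, by simpa using ha⟩

theorem sum_card_reps_sdiff_le {A T : Finset G} (hT : ∀ a ∈ A, ∀ b ∈ A, a ≠ b → a + b ∈ T) :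
    ∑ x ∈ (A + A) \ T, #(A.filter fun b => x - b ∈ A) ≤ #(A.filter fun a => a + a ∉ T) := by
  rw [card_eq_sum_card_fiberwise (f := fun a => a + a) (t := (A + A) \ T)]
  · refine sum_le_sum fun x hx => card_le_card fun b hb => ?_
    obtain ⟨hbA, hxb⟩ := mem_filter.1 hb
    have hxT := (mem_sdiff.1 hx).2
    have e : b = x - b := by
      by_contra hne
      exact hxT (by simpa using hT _ hbA _ hxb hne)
    have e2 : b + b = x := by nth_rewrite 2 [e]; abel
    exact mem_filter.2 ⟨mem_filter.2 ⟨hbA, by rwa [e2]⟩, e2⟩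
  · intro a ha
    obtain ⟨haA, haT⟩ := mem_filter.1 ha
    exact mem_sdiff.2 ⟨add_mem_add haA haA, haT⟩

theorem card_sq_le_of_reps_bound {A T S : Finset G} (h0A : 0 ∈ A) (h0T : 0 ∈ T)
    (hT : ∀ a ∈ A, ∀ b ∈ A, a ≠ b → a + b ∈ T) (hTA : T ⊆ A + A)
    (hS : S ⊆ A.filter fun a => a + a ∉ T) (hlarge : 2 * #A ≤ #T + 3 + #S)
    (hreps : ∀ a₀ ∈ S, ∀ a ∈ A, a₀ + a ∈ T →
      #(A.filter fun b => a₀ + a - b ∈ A) + #A ≤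
        #T + 1 + #(({a₀ + a₀, a + a} : Finset G) \ T)) :
    (#A * #A + #S : ℤ) ≤ #T * (#T - #A + 3) + #(A.filter fun a => a + a ∉ T) := by
  have hsum := sum_card_reps A
  rw [← sum_sdiff hTA] at hsum
  have hD := sum_card_reps_sdiff_le hT
  have hST : S ⊆ T := by
    intro a ha
    obtain ⟨haA, haT⟩ := mem_filter.1 (hS ha)
    have hne : a ≠ 0 := fun h => haT (by rw [h, add_zero]; exact h0T)
    simpa using hT a haA 0 h0A hne
  have hpt : ∀ x ∈ T, (#(A.filter fun b => x - b ∈ A) : ℤ) ≤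
      (#T - #A + 3) - if x ∈ S then 1 else 0 := by
    intro x hx
    by_cases hxS : x ∈ S
    · have h := hreps x hxS 0 h0A (by simpa using hx)
      have h2 : #(({x + x, 0 + 0} : Finset G) \ T) ≤ 1 := by
        refine (card_le_card (t := {x + x}) fun y hy => ?_).trans (card_singleton _).le
        obtain ⟨hy1, hy2⟩ := mem_sdiff.1 hy
        rw [mem_insert, mem_singleton, add_zero] at hy1
        rcases hy1 with h | h
        · exact mem_singleton.2 h
        · exact absurd (h ▸ h0T) hy2
      simp only [hxS, if_true]
      simp only [add_zero] at h h2
      omega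
    · simp only [hxS, if_false, sub_zero]
      by_cases hxA : ∃ a₀ ∈ S, ∃ a ∈ A, a₀ + a = x
      · obtain ⟨a₀, ha₀, a, ha, rfl⟩ := hxA
        have h := hreps a₀ ha₀ a ha hx
        have h2 : #(({a₀ + a₀, a + a} : Finset G) \ T) ≤ 2 :=
          (card_le_card sdiff_subset).trans card_le_two
        omega
      · push Not at hxA
        have h : A.filter (fun b => x - b ∈ A) ⊆ A \ S := by
          intro b hb
          obtain ⟨hbA, hxb⟩ := mem_filter.1 hb
          exact mem_sdiff.2 ⟨hbA, fun hbS => hxA b hbS _ hxb (by abel)⟩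
        have h1 := card_le_card h
        have h2 := card_sdiff_add_card_eq_card (hS.trans (filter_subset _ _))
        omega
  have hsumT := sum_le_sum hpt
  rw [sum_sub_distrib, sum_const, nsmul_eq_mul, sum_ite_mem, inter_eq_right.2 hST, sum_const,
    nsmul_eq_mul, mul_one] at hsumT
  have hsum' : (∑ x ∈ (A + A) \ T, #(A.filter fun b => x - b ∈ A) : ℤ) +
      ∑ x ∈ T, (#(A.filter fun b => x - b ∈ A) : ℤ) = #A * #A := by exact_mod_cast hsum
  have hD' : (∑ x ∈ (A + A) \ T, #(A.filter fun b => x - b ∈ A) : ℤ) ≤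
    #(A.filter fun a => a + a ∉ T) := by exact_mod_cast hD
  linarith

end RestrictedSums

theorem theta_bounds : 1.618 < theta ∧ theta < 1.6181 ∧ theta * theta = theta + 1 := by
  have h5 : Real.sqrt 5 * Real.sqrt 5 = 5 := Real.mul_self_sqrt (by norm_num)
  have h0 : 0 ≤ Real.sqrt 5 := Real.sqrt_nonneg 5
  unfold theta
  refine ⟨?_, ?_, ?_⟩
  · nlinarith
  · nlinarith
  · nlinarith

theorem theta_bound_of_sq_le {m t e : ℕ} (hm : 3 ≤ m) (he : e ≤ 2 ∨ (e ≤ 4 ∧ 6 ≤ m))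
    (h : (m * m : ℤ) ≤ t * (t - m + 3) + e) : theta * ((m : ℝ) + 1) - 4 ≤ t := by
  obtain ⟨h1, h2, h3⟩ := theta_bounds
  have hR : (m * m : ℝ) ≤ t * (t - m + 3) + e := by exact_mod_cast h
  have hm' : (3 : ℝ) ≤ m := by exact_mod_cast hm
  have ht : (0 : ℝ) ≤ t := Nat.cast_nonneg t
  have heR : (e : ℝ) < 0.47 * m + 1.4 := by
    rcases he with he | ⟨he, hm6⟩
    · have : (e : ℝ) ≤ 2 := by exact_mod_cast he
      linarith
    · have h4 : (e : ℝ) ≤ 4 := by exact_mod_cast he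
      have h6 : (6 : ℝ) ≤ m := by exact_mod_cast hm6
      linarith
  by_contra hlt
  push Not at hlt
  set u : ℝ := theta * ((m : ℝ) + 1) - 4 with hu
  have hu0 : 0 < u := by rw [hu]; nlinarith
  have hup : 0 < u - m + 3 := by rw [hu]; nlinarith
  have hmono : (t : ℝ) * (t - m + 3) ≤ u * (u - m + 3) := by
    by_cases hneg : (t : ℝ) - m + 3 ≤ 0
    · have : (t : ℝ) * (t - m + 3) ≤ 0 := mul_nonpos_of_nonneg_of_nonpos ht hneg
      have := mul_pos hu0 hup
      linarith
    · exact mul_le_mul hlt.le (by linarith) (by linarith) hu0.le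
  have hval : u * (u - m + 3) = m * m + (6 - 4 * theta) * m + (5 - 4 * theta) := by
    have : u * (u - m + 3) = theta * theta * (m + 1) * (m + 1) - theta * (m + 1) * (m + 5) +
        4 * (m + 1) := by rw [hu]; ring
    rw [this, h3]; ring
  nlinarith

section RestrictedSums

open Finset

variable {G : Type*} [AddCommGroup G] [DecidableEq G]

theorem theta_bound_of_exists_missing_double [Finite G] {A T : Finset G} {τ : G} (hτ₂ : τ + τ = 0)
    (hτ : ∀ x : G, x + x = 0 → x = 0 ∨ x = τ) (hm : 3 ≤ #A) (h0A : 0 ∈ A) (h0T : 0 ∈ T)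
    (hT : ∀ a ∈ A, ∀ b ∈ A, a ≠ b → a + b ∈ T) (hTA : T ⊆ A + A) (hne : T ≠ A + A) :
    theta * ((#A : ℝ) + 1) - 4 ≤ #T := by
  obtain ⟨hθ1, hθ2, -⟩ := theta_bounds
  have hmR : (3 : ℝ) ≤ #A := by exact_mod_cast hm
  set A₀ := A.filter fun a => a + a ∉ T with hA₀
  set P := A₀.filter fun a => τ ≠ 0 ∧ a + τ ∈ A with hP
  set S := A₀ \ P with hS
  set F := P.image fun a => a + a with hF
  have hSP : #S + #P = #A₀ := card_sdiff_add_card_eq_card (filter_subset _ _)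
  have h0A₀ : 0 ∉ A₀ := fun h => (mem_filter.1 h).2 (by rwa [add_zero])
  have hA₀card : #A₀ + 1 ≤ #A := by
    rw [← card_insert_of_notMem h0A₀]
    exact card_le_card (insert_subset h0A (filter_subset _ _))
  have hshift : ∀ a : G, a + τ + (a + τ) = a + a := fun a => by
    have : a + τ + (a + τ) = a + a + (τ + τ) := by abel
    rw [this, hτ₂, add_zero]
  have hfib : ∀ a b : G, b + b = a + a → b = a ∨ b = a + τ := by
    intro a b h
    have e : (b - a) + (b - a) = 0 := by
      have : (b - a) + (b - a) = b + b - (a + a) := by abel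
      rw [this, h, sub_self]
    rcases hτ _ e with h | h
    · exact Or.inl (sub_eq_zero.1 h)
    · exact Or.inr (by rw [← h]; abel)
  have hPF : #P ≤ 2 * #F := by
    refine card_le_mul_card_image P 2 fun f hf => ?_
    obtain ⟨a, ha, rfl⟩ := mem_image.1 hf
    refine (card_le_card (t := {a, a + τ}) fun b hb => ?_).trans card_le_two
    simpa using hfib a b (mem_filter.1 hb).2
  have hFP : 2 * #F ≤ #P := by
    refine mul_card_image_le_card P 2 fun f hf => ?_
    obtain ⟨a, ha, rfl⟩ := mem_image.1 hf
    obtain ⟨ha₀, hτ0, haτ⟩ := mem_filter.1 ha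
    obtain ⟨haA, haT⟩ := mem_filter.1 ha₀
    have : a ≠ a + τ := by simpa using hτ0
    rw [← card_pair this]
    refine card_le_card fun b hb => ?_
    rw [mem_insert, mem_singleton] at hb
    rcases hb with rfl | rfl
    · exact mem_filter.2 ⟨ha, rfl⟩
    · refine mem_filter.2 ⟨mem_filter.2 ⟨mem_filter.2 ⟨haτ, by rwa [hshift]⟩, hτ0, ?_⟩, hshift a⟩
      rwa [add_assoc, hτ₂, add_zero]
  have hD : (A + A) \ T = A₀.image fun a => a + a := by
    ext x
    simp only [mem_sdiff, mem_image, hA₀, mem_filter]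
    constructor
    · rintro ⟨hx, hxT⟩
      obtain ⟨a, ha, b, hb, rfl⟩ := mem_add.1 hx
      have : a = b := by
        by_contra h
        exact hxT (hT a ha b hb h)
      subst this
      exact ⟨a, ⟨ha, hxT⟩, rfl⟩
    · rintro ⟨a, ⟨ha, haT⟩, rfl⟩
      exact ⟨add_mem_add ha ha, haT⟩
  have hDcard : #((A + A) \ T) ≤ #S + #F := by
    have : A₀ = S ∪ P := (sdiff_union_of_subset (filter_subset _ _)).symm
    rw [hD, this, image_union]
    exact (card_union_le _ _).trans (Nat.add_le_add_right card_image_le _)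
  have hDcard' : #((A + A) \ T) ≤ #A₀ := by rw [hD]; exact card_image_le
  have hsplit : #((A + A) \ T) + #T = #(A + A) := card_sdiff_add_card_eq_card hTA
  have hDpos : 0 < #((A + A) \ T) := by
    rw [card_pos, sdiff_nonempty]
    exact fun h => hne (hTA.antisymm h)
  have hrepsub : ∀ a ∈ A₀, ∀ b ∈ A.filter (fun y => a + a - y ∈ A), b = a ∨ b = a + τ := by
    intro a ha b hb
    obtain ⟨hbA, hb⟩ := mem_filter.1 hb
    apply hfib
    have : b = a + a - b := by
      by_contra h
      apply (mem_filter.1 ha).2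
      simpa using hT _ hbA _ hb h
    nth_rewrite 2 [this]; abel
  have hKS : 2 * #A ≤ #(A + A) + 2 := by
    obtain ⟨d, hd⟩ := card_pos.1 hDpos
    rw [hD] at hd
    obtain ⟨a, ha, rfl⟩ := mem_image.1 hd
    have haA := (mem_filter.1 ha).1
    have h := card_add_card_le_card_add_add_card_reps A A (add_mem_add haA haA)
    have : #(A.filter fun y => a + a - y ∈ A) ≤ 2 :=
      (card_le_card (t := {a, a + τ}) fun b hb => by
        simpa using hrepsub a ha b hb).trans card_le_two
    omega
  by_cases hF3 : 3 ≤ #F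
  · have h := card_sq_le_of_reps_bound h0A h0T hT hTA (S := A₀) subset_rfl (by omega)
      fun a₀ ha₀ a ha _ => by
        obtain ⟨ha₀A, ha₀T⟩ := mem_filter.1 ha₀
        refine card_reps_le_of_double_notMem hτ₂ hτ hT ha₀A ha ha₀T (Or.inr ?_)
        obtain ⟨x, hx, hxn⟩ := exists_mem_notMem_of_card_lt_card
          (lt_of_le_of_lt (card_le_two (a := a₀ + a₀) (b := a + a)) hF3)
        obtain ⟨f, hf, rfl⟩ := mem_image.1 hx
        obtain ⟨hf₀, hτ0, hfτ⟩ := mem_filter.1 hf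
        obtain ⟨hfA, hfT⟩ := mem_filter.1 hf₀
        simp only [mem_insert, mem_singleton, not_or] at hxn
        exact ⟨f, hfA, hτ0, hfτ, hfT, hxn.1, hxn.2⟩
    exact theta_bound_of_sq_le (e := 0) hm (by omega) (by push_cast; linarith)
  by_cases hSe : S = ∅
  · rw [hSe, card_empty] at hDcard hSP
    have : 2 * #A ≤ #T + 3 ∨ (2 * #A ≤ #T + 4 ∧ 5 ≤ #A) := by omega
    rcases this with h | ⟨h, h5⟩
    · have : (2 * #A : ℝ) ≤ #T + 3 := by exact_mod_cast h
      nlinarith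
    · have : (2 * #A : ℝ) ≤ #T + 4 := by exact_mod_cast h
      have : (5 : ℝ) ≤ #A := by exact_mod_cast h5
      nlinarith
  obtain ⟨a, ha⟩ := nonempty_iff_ne_empty.2 hSe
  have hSpos : 0 < #S := card_pos.2 ⟨a, ha⟩
  have hSA₀ : S ⊆ A₀ := sdiff_subset
  have hunp : ∀ a ∈ S, ¬ (τ ≠ 0 ∧ a + τ ∈ A) := fun a ha h =>
    (mem_sdiff.1 ha).2 (mem_filter.2 ⟨hSA₀ ha, h⟩)
  have hKS1 : 2 * #A ≤ #(A + A) + 1 := by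
    have haA := (mem_filter.1 (hSA₀ ha)).1
    have h := card_add_card_le_card_add_add_card_reps A A (add_mem_add haA haA)
    have : #(A.filter fun y => a + a - y ∈ A) ≤ 1 := by
      refine (card_le_card (t := {a}) fun b hb => mem_singleton.2 ?_).trans (card_singleton a).le
      rcases hrepsub a (hSA₀ ha) b hb with h | h
      · exact h
      · by_contra hba
        exact hunp a ha ⟨fun h0 => hba (by rw [h, h0, add_zero]), h ▸ (mem_filter.1 hb).1⟩
    omega
  have h := card_sq_le_of_reps_bound h0A h0T hT hTA (S := S) hSA₀ (by omega)
    fun a₀ ha₀ a ha _ => by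
      obtain ⟨ha₀A, ha₀T⟩ := mem_filter.1 (hSA₀ ha₀)
      exact card_reps_le_of_double_notMem hτ₂ hτ hT ha₀A ha ha₀T
        (Or.inl fun hh => hunp a₀ ha₀ hh.2)
  refine theta_bound_of_sq_le (e := #P) hm (by omega) ?_
  have : (#S + #P : ℤ) = #A₀ := by exact_mod_cast hSP
  linarith

end RestrictedSums

section Dichotomy

open Finset

theorem card_add_self_or_two_cosets {G : Type*} [AddCommGroup G] [DecidableEq G] [Fintype G]
    {A : Finset G} (h0A : 0 ∈ A) (hgen : ∀ H : AddSubgroup G, (∀ a ∈ A, a ∈ H) → H = ⊤)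
    (hAA : A + A ≠ univ) :
    5 * #A ≤ 3 * #(A + A) ∨
      ∃ H : AddSubgroup G, ∃ c ∈ A, c ∉ H ∧ c + c ∉ H ∧ ∀ a ∈ A, a ∈ H ∨ a - c ∈ H := by
  obtain ⟨H, K, hKH, hKA, hcard⟩ := exists_subgroup_card_add_le A A ⟨0, h0A⟩ hAA
  by_cases h3 : 3 * #K ≤ #(K + A)
  · left
    have h0K : 0 ∈ K := (hKH 0).2 H.zero_mem
    have : #A ≤ #(K + A) := card_le_card fun a ha => mem_add.2 ⟨0, h0K, a, ha, zero_add a⟩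
    omega
  right
  have hc : ∃ c ∈ A, c ∉ H := by
    by_contra! h
    apply hKA
    rw [eq_univ_iff_forall]
    intro g
    refine mem_add.2 ⟨g, (hKH g).2 ?_, 0, h0A, add_zero g⟩
    rw [hgen H h]; trivial
  obtain ⟨c, hcA, hcH⟩ := hc
  have hcos : ∀ a ∈ A, a ∈ H ∨ a - c ∈ H := by
    intro a ha
    by_contra! hac
    apply h3
    have hd1 : Disjoint K (K.image (· + c)) := by
      rw [disjoint_left]
      intro x hx hxc
      obtain ⟨y, hy, rfl⟩ := mem_image.1 hxc
      exact hcH (by simpa using H.sub_mem ((hKH _).1 hx) ((hKH _).1 hy))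
    have hd2 : Disjoint (K ∪ K.image (· + c)) (K.image (· + a)) := by
      rw [disjoint_left]
      intro x hx hxa
      obtain ⟨y, hy, rfl⟩ := mem_image.1 hxa
      rcases mem_union.1 hx with hx | hx
      · exact hac.1 (by simpa using H.sub_mem ((hKH _).1 hx) ((hKH _).1 hy))
      · obtain ⟨z, hz, hzy⟩ := mem_image.1 hx
        replace hzy : z + c = y + a := hzy
        apply hac.2
        have : a - c = z - y := by
          rw [sub_eq_sub_iff_add_eq_add, hzy, add_comm]
        rw [this]
        exact H.sub_mem ((hKH _).1 hz) ((hKH _).1 hy)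
    have hsub : (K ∪ K.image (· + c)) ∪ K.image (· + a) ⊆ K + A := by
      refine union_subset (union_subset ?_ ?_) ?_
      · exact fun x hx => mem_add.2 ⟨x, hx, 0, h0A, add_zero x⟩
      · exact image_subset_iff.2 fun x hx => add_mem_add hx hcA
      · exact image_subset_iff.2 fun x hx => add_mem_add hx ha
    have := card_le_card hsub
    rw [card_union_of_disjoint hd2, card_union_of_disjoint hd1,
      card_image_of_injective _ (add_left_injective c),
      card_image_of_injective _ (add_left_injective a)] at this
    omega
  refine ⟨H, c, hcA, hcH, fun hcc => hKA ?_, hcos⟩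
  let L : AddSubgroup G :=
    { carrier := {g | g ∈ H ∨ g - c ∈ H}
      zero_mem' := Or.inl H.zero_mem
      add_mem' := by
        rintro x y (hx | hx) (hy | hy)
        · exact Or.inl (H.add_mem hx hy)
        · right
          have := H.add_mem hx hy
          rwa [← add_sub_assoc] at this
        · right
          have := H.add_mem hx hy
          rwa [sub_add_eq_add_sub] at this
        · left
          have := H.add_mem (H.add_mem hx hy) hcc
          have e : x - c + (y - c) + (c + c) = x + y := by abel
          rwa [e] at this
      neg_mem' := by
        rintro x (hx | hx)
        · exact Or.inl (H.neg_mem hx)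
        · right
          have := H.neg_mem (H.add_mem hx hcc)
          have e : -(x - c + (c + c)) = -x - c := by abel
          rwa [e] at this }
  have hL : L = ⊤ := hgen L hcos
  rw [eq_univ_iff_forall]
  intro g
  have hg : g ∈ L := by rw [hL]; trivial
  rcases hg with hg | hg
  · exact mem_add.2 ⟨g, (hKH g).2 hg, 0, h0A, add_zero g⟩
  · exact mem_add.2 ⟨_, (hKH _).2 hg, c, hcA, sub_add_cancel g c⟩

theorem mem_Res2 {A : Finset ℤ} {x : ℤ} : x ∈ Res2 A ↔ ∃ a ∈ A, ∃ b ∈ A, a ≠ b ∧ a + b = x := by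
  simp only [Res2, mem_image, mem_filter, mem_product, Prod.exists]
  constructor
  · rintro ⟨a, b, ⟨⟨ha, hb⟩, hne⟩, rfl⟩; exact ⟨a, ha, b, hb, hne, rfl⟩
  · rintro ⟨a, ha, b, hb, hne, rfl⟩; exact ⟨a, b, ⟨⟨ha, hb⟩, hne⟩, rfl⟩

theorem two_mul_card_le_card_Res2 (A : Finset ℤ) (hA : A.Nonempty) : 2 * #A ≤ #(Res2 A) + 3 := by
  set p := A.min' hA
  set q := A.max' hA
  have hp : p ∈ A := A.min'_mem hA
  have hq : q ∈ A := A.max'_mem hA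
  have h1 : (A.erase p).image (p + ·) ∪ (A.erase q).image (q + ·) ⊆ Res2 A := by
    refine union_subset ?_ ?_
    · refine image_subset_iff.2 fun x hx => mem_Res2.2 ⟨p, hp, x, (mem_erase.1 hx).2, ?_, rfl⟩
      exact (mem_erase.1 hx).1.symm
    · refine image_subset_iff.2 fun x hx => mem_Res2.2 ⟨q, hq, x, (mem_erase.1 hx).2, ?_, rfl⟩
      exact (mem_erase.1 hx).1.symm
  have h2 : (A.erase p).image (p + ·) ∩ (A.erase q).image (q + ·) ⊆ {p + q} := by
    intro x hx
    obtain ⟨hx1, hx2⟩ := mem_inter.1 hx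
    obtain ⟨y, hy, rfl⟩ := mem_image.1 hx1
    obtain ⟨z, hz, hzy⟩ := mem_image.1 hx2
    have hy' := A.le_max' y (mem_erase.1 hy).2
    have hz' := A.min'_le z (mem_erase.1 hz).2
    rw [mem_singleton]
    change y ≤ q at hy'
    change p ≤ z at hz'
    omega
  have h3 := card_union_add_card_inter ((A.erase p).image (p + ·)) ((A.erase q).image (q + ·))
  rw [card_image_of_injective _ (add_right_injective p),
    card_image_of_injective _ (add_right_injective q), card_erase_of_mem hp,
    card_erase_of_mem hq] at h3
  have h4 := card_le_card h1
  have h5 := card_le_card h2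
  rw [card_singleton] at h5
  omega

theorem three_mul_card_le_of_two_cosets {A : Finset ℤ} (hpos : ∀ a ∈ A, 0 < a)
    (H : AddSubgroup ℤ) {c : ℤ} (hcA : c ∈ A) (hc : c ∉ H) (hcc : c + c ∉ H)
    (hcos : ∀ a ∈ A, a ∈ H ∨ a - c ∈ H) :
    3 * #A ≤ #(insert 0 (Res2 (insert 0 A))) + 3 := by
  classical
  set A₀ := A.filter (· ∈ H) with hA₀
  set A₁ := A.filter (· ∉ H) with hA₁
  have hA : #A₀ + #A₁ = #A := card_filter_add_card_filter_not _
  set B₀ := insert 0 A₀ with hB₀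
  have h0A₀ : 0 ∉ A₀ := fun h => (hpos 0 (mem_filter.1 h).1).false
  have hB₀c : #B₀ = #A₀ + 1 := card_insert_of_notMem h0A₀
  have hB₀H : ∀ b ∈ B₀, b ∈ H := by
    intro b hb
    rcases mem_insert.1 hb with rfl | hb
    · exact H.zero_mem
    · exact (mem_filter.1 hb).2
  have hB₀A : B₀ ⊆ insert 0 A := insert_subset_insert _ (filter_subset _ _)
  have hA₁A : A₁ ⊆ insert 0 A := (filter_subset _ _).trans (subset_insert _ _)
  have hA₁c : ∀ a ∈ A₁, a - c ∈ H := fun a ha =>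
    (hcos a (mem_filter.1 ha).1).resolve_left (mem_filter.1 ha).2
  have hA₁ne : A₁.Nonempty := ⟨c, mem_filter.2 ⟨hcA, hc⟩⟩
  have hB₀nn : ∀ b ∈ B₀, 0 ≤ b := by
    intro b hb
    rcases mem_insert.1 hb with rfl | hb
    · exact le_rfl
    · exact (hpos b (mem_filter.1 hb).1).le
  have hmono : ∀ X : Finset ℤ, X ⊆ insert 0 A → Res2 X ⊆ Res2 (insert 0 A) := by
    intro X hX x hx
    obtain ⟨a, ha, b, hb, h⟩ := mem_Res2.1 hx
    exact mem_Res2.2 ⟨a, hX ha, b, hX hb, h⟩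
  have h0R : 0 ∉ Res2 B₀ := by
    intro h
    obtain ⟨a, ha, b, hb, hne, h⟩ := mem_Res2.1 h
    have := hB₀nn a ha
    have := hB₀nn b hb
    omega
  have hX : ∀ x ∈ insert 0 (Res2 B₀), x ∈ H := by
    intro x hx
    rcases mem_insert.1 hx with rfl | hx
    · exact H.zero_mem
    · obtain ⟨a, ha, b, hb, -, rfl⟩ := mem_Res2.1 hx
      exact H.add_mem (hB₀H a ha) (hB₀H b hb)
  have hY : ∀ x ∈ B₀ + A₁, x - c ∈ H := by
    intro x hx
    obtain ⟨a, ha, b, hb, rfl⟩ := mem_add.1 hx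
    rw [add_sub_assoc]
    exact H.add_mem (hB₀H a ha) (hA₁c b hb)
  have hZ : ∀ x ∈ Res2 A₁, x - (c + c) ∈ H := by
    intro x hx
    obtain ⟨a, ha, b, hb, -, rfl⟩ := mem_Res2.1 hx
    rw [add_sub_add_comm]
    exact H.add_mem (hA₁c a ha) (hA₁c b hb)
  have hXY : Disjoint (insert 0 (Res2 B₀)) (B₀ + A₁) := by
    rw [disjoint_left]
    intro x hx hy
    exact hc (by simpa using H.sub_mem (hX x hx) (hY x hy))
  have hXYZ : Disjoint (insert 0 (Res2 B₀) ∪ (B₀ + A₁)) (Res2 A₁) := by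
    rw [disjoint_left]
    intro x hx hz
    rcases mem_union.1 hx with hx | hx
    · exact hcc (by simpa using H.sub_mem (hX x hx) (hZ x hz))
    · refine hc ?_
      have := H.sub_mem (hY x hx) (hZ x hz)
      rwa [sub_sub_sub_cancel_left, add_sub_cancel_left] at this
  have hsub : (insert 0 (Res2 B₀) ∪ (B₀ + A₁)) ∪ Res2 A₁ ⊆ insert 0 (Res2 (insert 0 A)) := by
    refine union_subset (union_subset (insert_subset_insert _ (hmono _ hB₀A)) ?_)
      ((hmono _ hA₁A).trans (subset_insert _ _))
    intro x hx
    obtain ⟨a, ha, b, hb, rfl⟩ := mem_add.1 hx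
    refine mem_insert_of_mem (mem_Res2.2 ⟨a, hB₀A ha, b, hA₁A hb, ?_, rfl⟩)
    rintro rfl
    exact (mem_filter.1 hb).2 (hB₀H a ha)
  have h := card_le_card hsub
  rw [card_union_of_disjoint hXYZ, card_union_of_disjoint hXY, card_insert_of_notMem h0R] at h
  have h1 := two_mul_card_le_card_Res2 B₀ ⟨0, mem_insert_self _ _⟩
  have h2 := two_mul_card_le_card_Res2 A₁ hA₁ne
  have h3 := cauchy_davenport_add_of_linearOrder_isCancelAdd (s := B₀) (t := A₁)
    ⟨0, mem_insert_self _ _⟩ hA₁ne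
  have := hA₁ne.card_pos
  omega

end Dichotomy

section Integers

open Finset

theorem exists_two_torsion_zmod (n : ℕ) [NeZero n] :
    ∃ τ : ZMod n, τ + τ = 0 ∧ ∀ x : ZMod n, x + x = 0 → x = 0 ∨ x = τ := by
  by_cases h : ∃ x : ZMod n, x ≠ 0 ∧ x + x = 0
  · obtain ⟨τ, hτ0, hτ⟩ := h
    have key : ∀ y : ZMod n, y ≠ 0 → y + y = 0 → 2 * y.val = n := by
      intro y hy0 hy
      have h1 : ((y.val + y.val : ℕ) : ZMod n) = 0 := by
        push_cast; rw [ZMod.natCast_zmod_val]; exact hy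
      rw [ZMod.natCast_eq_zero_iff] at h1
      obtain ⟨q, hq⟩ := h1
      have h2 : y.val < n := ZMod.val_lt y
      have h3 : y.val ≠ 0 := fun h => hy0 ((ZMod.val_eq_zero y).1 h)
      have h4 : q < 2 := by
        by_contra h
        have : n * 2 ≤ n * q := Nat.mul_le_mul_left _ (by omega)
        omega
      interval_cases q <;> omega
    refine ⟨τ, hτ, fun x hx => ?_⟩
    by_cases hx0 : x = 0
    · exact Or.inl hx0
    · right
      have h1 := key x hx0 hx
      have h2 := key τ hτ0 hτ
      exact ZMod.val_injective n (by omega)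
  · push Not at h
    refine ⟨0, add_zero 0, fun x hx => Or.inl ?_⟩
    by_contra h0
    exact h x h0 hx

theorem eq_univ_of_card_lt {G : Type*} [AddCommGroup G] [DecidableEq G] [Fintype G]
    {A T : Finset G} {τ : G} (hτ : ∀ x : G, x + x = 0 → x = 0 ∨ x = τ)
    (hT : ∀ a ∈ A, ∀ b ∈ A, a ≠ b → a + b ∈ T) (hcard : Fintype.card G + 3 ≤ 2 * #A) :
    T = univ := by
  rw [eq_univ_iff_forall]
  intro g
  by_contra hg
  have h1 := card_union_add_card_inter A (A.image (g - ·))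
  rw [card_image_of_injective _ sub_right_injective] at h1
  have h2 : #(A ∪ A.image (g - ·)) ≤ Fintype.card G := card_le_univ _
  have h3 : 3 ≤ #(A ∩ A.image (g - ·)) := by omega
  have hd : ∀ x ∈ A ∩ A.image (g - ·), x + x = g := by
    intro x hx
    obtain ⟨hxA, hx⟩ := mem_inter.1 hx
    obtain ⟨y, hy, rfl⟩ := mem_image.1 hx
    by_contra hne
    refine hg ?_
    have := hT (g - y) hxA y hy fun h => hne (by nth_rewrite 2 [h]; abel)
    simpa using this
  obtain ⟨x, hx⟩ : (A ∩ A.image (g - ·)).Nonempty := card_pos.1 (by omega)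
  have h4 : A ∩ A.image (g - ·) ⊆ {x, x + τ} := by
    intro y hy
    have e : (y - x) + (y - x) = 0 := by
      have : (y - x) + (y - x) = y + y - (x + x) := by abel
      rw [this, hd x hx, hd y hy, sub_self]
    rw [mem_insert, mem_singleton]
    rcases hτ _ e with h | h
    · exact Or.inl (sub_eq_zero.1 h)
    · exact Or.inr (by rw [← h]; abel)
  have := (card_le_card h4).trans card_le_two
  omega

/-- Lev's bound for the restricted doubling of `{0} ∪ A`, with `0` itself adjoined. -/
theorem restricted_doubling_bound {A : Finset ℤ} {l : ℤ} (hl : l ∈ A) (hpos : ∀ a ∈ A, 0 < a)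
    (hle : ∀ a ∈ A, a ≤ l) (hgen : ∀ H : AddSubgroup ℤ, (∀ a ∈ A, a ∈ H) → H = ⊤)
    (hk : 3 ≤ #A) :
    (l ≤ 2 * #A - 3 → l + #A ≤ #(insert 0 (Res2 (insert 0 A)))) ∧
    (2 * #A - 2 ≤ l → theta * ((#A : ℝ) + 1) - 4 + #A ≤ #(insert 0 (Res2 (insert 0 A)))) := by
  obtain ⟨n, rfl⟩ := Int.eq_ofNat_of_zero_le (hpos l hl).le
  have hn0 : 0 < n := by exact_mod_cast hpos _ hl
  have : NeZero n := ⟨hn0.ne'⟩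
  set U := insert 0 (Res2 (insert 0 A)) with hU
  set φ : ℤ →+ ZMod n := Int.castAddHom (ZMod n) with hφ
  have hφeq : ∀ x y : ℤ, φ x = φ y ↔ (n : ℤ) ∣ y - x := fun x y =>
    ZMod.intCast_eq_intCast_iff_dvd_sub x y n
  have hφn : φ n = 0 := by simp [hφ]
  have hφsurj : Function.Surjective φ := ZMod.intCast_surjective
  have hinj : Set.InjOn φ A := by
    intro x hx y hy hxy
    have hd := (hφeq x y).1 hxy
    have h1 := hpos x hx
    have h2 := hpos y hy
    have h3 := hle x hx
    have h4 := hle y hy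
    have := Int.eq_zero_of_abs_lt_dvd hd (abs_lt.2 ⟨by omega, by omega⟩)
    omega
  set A' := A.image φ with hA'
  set T := U.image φ with hT
  have hcardA' : #A' = #A := card_image_of_injOn hinj
  have h0A' : 0 ∈ A' := mem_image.2 ⟨n, hl, hφn⟩
  have h0U : 0 ∈ U := mem_insert_self _ _
  have h0T : 0 ∈ T := mem_image.2 ⟨0, h0U, map_zero φ⟩
  have hAU : ∀ a ∈ A, a ∈ U := fun a ha =>
    mem_insert_of_mem (mem_Res2.2 ⟨0, mem_insert_self _ _, a, mem_insert_of_mem ha,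
      (hpos a ha).ne, zero_add a⟩)
  have hAAU : ∀ a ∈ A, ∀ b ∈ A, a ≠ b → a + b ∈ U := fun a ha b hb hne =>
    mem_insert_of_mem (mem_Res2.2 ⟨a, mem_insert_of_mem ha, b, mem_insert_of_mem hb, hne, rfl⟩)
  have hres : ∀ a ∈ A', ∀ b ∈ A', a ≠ b → a + b ∈ T := by
    intro a ha b hb hne
    obtain ⟨x, hx, rfl⟩ := mem_image.1 ha
    obtain ⟨y, hy, rfl⟩ := mem_image.1 hb
    exact mem_image.2 ⟨x + y, hAAU x hx y hy fun h => hne (h ▸ rfl), map_add φ x y⟩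
  have hφA : ∀ x ∈ insert 0 A, φ x ∈ A' := by
    intro x hx
    rcases mem_insert.1 hx with rfl | hx
    · rwa [map_zero]
    · exact mem_image_of_mem _ hx
  have hTA : T ⊆ A' + A' := by
    refine image_subset_iff.2 fun x hx => ?_
    rcases mem_insert.1 hx with rfl | hx
    · rw [map_zero, ← add_zero (0 : ZMod n)]
      exact add_mem_add h0A' h0A'
    · obtain ⟨a, ha, b, hb, -, rfl⟩ := mem_Res2.1 hx
      rw [map_add]
      exact add_mem_add (hφA a ha) (hφA b hb)
  -- each residue of `A` is attained at least twice in `U`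
  have hUT : #T + #A ≤ #U := by
    set V := insert (n : ℤ) ((A.erase n).image (· + (n : ℤ))) with hV
    have hnV : (n : ℤ) ∉ (A.erase n).image (· + (n : ℤ)) := by
      intro h
      obtain ⟨a, ha, han⟩ := mem_image.1 h
      have := hpos a (mem_erase.1 ha).2
      omega
    have hVcard : #V = #A := by
      rw [hV, card_insert_of_notMem hnV, card_image_of_injective _ (add_left_injective _),
        card_erase_add_one hl]
    have hVU : V ⊆ U := by
      refine insert_subset (hAU _ hl) (image_subset_iff.2 fun a ha => ?_)
      exact hAAU a (mem_erase.1 ha).2 n hl (mem_erase.1 ha).1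
    have hVn : ∀ v ∈ V, (n : ℤ) ≤ v := by
      intro v hv
      rcases mem_insert.1 hv with rfl | hv
      · exact le_rfl
      · obtain ⟨a, ha, rfl⟩ := mem_image.1 hv
        have := hpos a (mem_erase.1 ha).2
        omega
    have hTsub : T ⊆ (U \ V).image φ := by
      refine image_subset_iff.2 fun x hx => ?_
      by_cases hxV : x ∈ V
      · rcases mem_insert.1 hxV with rfl | hxV
        · refine mem_image.2 ⟨0, mem_sdiff.2 ⟨h0U, fun h => ?_⟩, by rw [map_zero, hφn]⟩
          have := hVn 0 h
          omega
        · obtain ⟨a, ha, rfl⟩ := mem_image.1 hxV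
          obtain ⟨han, haA⟩ := mem_erase.1 ha
          refine mem_image.2 ⟨a, mem_sdiff.2 ⟨hAU a haA, fun h => ?_⟩, ?_⟩
          · have := hVn a h
            have := hle a haA
            omega
          · rw [map_add, hφn, add_zero]
      · exact mem_image_of_mem _ (mem_sdiff.2 ⟨hx, hxV⟩)
    have h1 := (card_le_card hTsub).trans card_image_le
    have h2 := card_sdiff_add_card_eq_card hVU
    omega
  have hgen' : ∀ H : AddSubgroup (ZMod n), (∀ a ∈ A', a ∈ H) → H = ⊤ := by
    intro H hH
    have h1 := hgen (H.comap φ) fun a ha => hH _ (mem_image_of_mem _ ha)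
    rw [eq_top_iff]
    intro g _
    obtain ⟨x, rfl⟩ := hφsurj g
    have : x ∈ H.comap φ := by rw [h1]; trivial
    exact this
  obtain ⟨τ, hτ₂, hτ⟩ := exists_two_torsion_zmod n
  have hUTR : (#T : ℝ) + #A ≤ #U := by exact_mod_cast hUT
  obtain ⟨hθ1, hθ2, -⟩ := theta_bounds
  have hkR : (3 : ℝ) ≤ #A := by exact_mod_cast hk
  constructor
  · intro hln
    have h := eq_univ_of_card_lt hτ hres (by rw [ZMod.card, hcardA']; omega)
    have : #T = n := by rw [h, card_univ, ZMod.card]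
    omega
  · intro hln
    by_cases hTeq : T = A' + A'
    · by_cases huniv : A' + A' = univ
      · have h : #T = n := by rw [hTeq, huniv, card_univ, ZMod.card]
        have h2 : 2 * #A ≤ #T + 2 := by omega
        have : (2 * #A : ℝ) ≤ #T + 2 := by exact_mod_cast h2
        nlinarith
      · rcases card_add_self_or_two_cosets h0A' hgen' huniv with h | ⟨H, c, hc, hcH, hccH, hcos⟩
        · rw [← hTeq, hcardA'] at h
          have : (5 * #A : ℝ) ≤ 3 * #T := by exact_mod_cast h
          nlinarith
        · obtain ⟨c, hcA, rfl⟩ := mem_image.1 hc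
          have h := three_mul_card_le_of_two_cosets hpos (H.comap φ) hcA hcH
            (by rwa [AddSubgroup.mem_comap, map_add]) fun a ha => by
              simp only [AddSubgroup.mem_comap, map_sub]
              exact hcos _ (mem_image_of_mem _ ha)
          have : (3 * #A : ℝ) ≤ #U + 3 := by exact_mod_cast h
          nlinarith
    · have h := theta_bound_of_exists_missing_double hτ₂ hτ (by rwa [hcardA']) h0A' h0T hres hTA hTeq
      rw [hcardA'] at h
      linarith

end Integers

section SubsetSums

open Finset

theorem mem_SetSubAlpha {α : ℕ} {A : Finset ℤ} {x : ℤ} :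
    x ∈ SetSubAlpha α A ↔ ∃ B ⊆ A, α ≤ #B ∧ ∑ b ∈ B, b = x := by
  simp [SetSubAlpha, and_assoc]

theorem card_SetSubAlpha_succ_add_le {A : Finset ℤ} (hpos : ∀ a ∈ A, 0 < a) {α : ℕ}
    (hα : α + 1 ≤ #A) : #(SetSubAlpha (α + 1) A) + (α + 1) ≤ #(SetSubAlpha α A) := by
  obtain ⟨B₀, hB₀, hmin⟩ := exists_min_image (A.powersetCard (α + 1)) (fun B => ∑ b ∈ B, b)
    (powersetCard_nonempty.2 hα)
  rw [mem_powersetCard] at hB₀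
  have hcard : #(B₀.image fun b => ∑ x ∈ B₀, x - b) = α + 1 := by
    rw [card_image_of_injective _ fun x y h => by simpa using h, hB₀.2]
  have hdisj : Disjoint (SetSubAlpha (α + 1) A) (B₀.image fun b => ∑ x ∈ B₀, x - b) := by
    refine disjoint_left.2 fun x hx hx' => ?_
    obtain ⟨B, hBA, hB, rfl⟩ := mem_SetSubAlpha.1 hx
    obtain ⟨b, hb, hxb⟩ := mem_image.1 hx'
    obtain ⟨C, hCB, hC⟩ := exists_subset_card_eq hB
    have h₁ := hmin C (mem_powersetCard.2 ⟨hCB.trans hBA, hC⟩)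
    have h₂ : ∑ x ∈ C, x ≤ ∑ x ∈ B, x :=
      sum_le_sum_of_subset_of_nonneg hCB fun i hi _ => (hpos i (hBA hi)).le
    have h₃ := hpos b (hB₀.1 hb)
    simp only at h₁ hxb
    omega
  have hunion := card_union_of_disjoint hdisj
  rw [hcard] at hunion
  rw [← hunion]
  refine card_le_card (union_subset (fun x hx => ?_) fun x hx => ?_)
  · obtain ⟨B, hBA, hB, h⟩ := mem_SetSubAlpha.1 hx
    exact mem_SetSubAlpha.2 ⟨B, hBA, by omega, h⟩
  · obtain ⟨b, hb, rfl⟩ := mem_image.1 hx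
    refine mem_SetSubAlpha.2 ⟨B₀.erase b, (erase_subset _ _).trans hB₀.1, ?_, ?_⟩
    · rw [card_erase_of_mem hb, hB₀.2]; omega
    · rw [← add_sum_erase _ _ hb]; ring

theorem card_SetSubAlpha_add_le {A : Finset ℤ} (hpos : ∀ a ∈ A, 0 < a) (α d : ℕ)
    (h : α + d ≤ #A) :
    2 * #(SetSubAlpha (α + d) A) + (α + d) * (α + d + 1) ≤
      2 * #(SetSubAlpha α A) + α * (α + 1) := by
  induction d with
  | zero => rfl
  | succ d ih =>
    have h₁ := ih (by omega)
    have h₂ := card_SetSubAlpha_succ_add_le hpos (α := α + d) (by omega)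
    rw [← add_assoc]
    nlinarith

theorem card_insert_zero_Res2_le {A : Finset ℤ} :
    #(insert 0 (Res2 (insert 0 A))) ≤ #(SetSubAlpha (#A - 2) A) := by
  refine card_le_card_of_injOn (fun u => ∑ x ∈ A, x - u) (fun u hu => ?_)
    fun x _ y _ h => by simpa using h
  obtain ⟨C, hCA, hC, rfl⟩ : ∃ C ⊆ A, #C ≤ 2 ∧ ∑ c ∈ C, c = u := by
    rcases mem_insert.1 hu with rfl | hu
    · exact ⟨∅, by simp⟩
    obtain ⟨a, ha, b, hb, hab, rfl⟩ := mem_Res2.1 hu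
    rcases mem_insert.1 ha with rfl | ha <;> rcases mem_insert.1 hb with rfl | hb
    · exact absurd rfl hab
    · exact ⟨{b}, by simpa using hb⟩
    · exact ⟨{a}, by simpa using ha⟩
    · exact ⟨{a, b}, by simp [insert_subset_iff, ha, hb], card_le_two, sum_pair hab⟩
  refine mem_SetSubAlpha.2 ⟨A \ C, sdiff_subset, ?_, ?_⟩
  · rw [card_sdiff_of_subset hCA]; omega
  · rw [← sum_sdiff hCA]; ring

theorem AddSubgroup.eq_top_of_gcd_eq_one {ι : Type*} {s : Finset ι} {f : ι → ℤ}
    (h : s.gcd f = 1) (H : AddSubgroup ℤ) (hH : ∀ i ∈ s, f i ∈ H) : H = ⊤ := by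
  obtain ⟨g, rfl⟩ := Int.subgroup_cyclic H
  rw [← AddSubgroup.zmultiples_eq_closure] at hH ⊢
  have hg : g ∣ 1 := h ▸ dvd_gcd fun i hi => Int.mem_zmultiples_iff.1 (hH i hi)
  exact (AddSubgroup.eq_top_iff' _).2 fun x => Int.mem_zmultiples_iff.2 (hg.trans (one_dvd x))

end SubsetSums

theorem freiman_alpha_subset_sum (k α : ℕ) (hk : 3 ≤ k) (hα1 : 1 ≤ α) (hα2 : α ≤ k - 2)
    (a : ℕ → ℤ)
    (ha : ∀ i j, 1 ≤ i → i < j → j ≤ k → a i < a j)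
    (hpos : ∀ i, 1 ≤ i → i ≤ k → 0 < a i)
    (hgcd : (Finset.Icc 1 k).gcd a = 1) :
    (a k ≤ 2 * (k : ℤ) - 3 →
      a k + (k : ℤ) * ((k : ℤ) - 1) / 2 - (α : ℤ) * ((α : ℤ) + 1) / 2 + 1
        ≤ ((SetSubAlpha α ((Finset.Icc 1 k).image a)).card : ℤ)) ∧
    (2 * (k : ℤ) - 2 ≤ a k →
      theta * ((k : ℝ) + 1) - 4 + (k : ℝ) * ((k : ℝ) - 1) / 2 - (α : ℝ) * ((α : ℝ) + 1) / 2 + 1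
        ≤ ((SetSubAlpha α ((Finset.Icc 1 k).image a)).card : ℝ)) := by
  set A := (Finset.Icc 1 k).image a with hA
  have hinj : Set.InjOn a (Finset.Icc 1 k) := by
    intro i hi j hj hij
    simp only [Finset.coe_Icc, Set.mem_Icc] at hi hj
    rcases lt_trichotomy i j with h | h | h
    · exact absurd hij (ha i j hi.1 h hj.2).ne
    · exact h
    · exact absurd hij (ha j i hj.1 h hi.2).ne'
  have hcard : A.card = k := by rw [hA, Finset.card_image_of_injOn hinj, Nat.card_Icc]; omega
  have hl : a k ∈ A := Finset.mem_image_of_mem _ (Finset.mem_Icc.2 ⟨by omega, le_rfl⟩)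
  have hApos : ∀ x ∈ A, 0 < x := Finset.forall_mem_image.2 fun i hi =>
    hpos i (Finset.mem_Icc.1 hi).1 (Finset.mem_Icc.1 hi).2
  have hle : ∀ x ∈ A, x ≤ a k := Finset.forall_mem_image.2 fun i hi => by
    rcases (Finset.mem_Icc.1 hi).2.eq_or_lt with rfl | h
    · rfl
    · exact (ha i k (Finset.mem_Icc.1 hi).1 h le_rfl).le
  have hgen : ∀ H : AddSubgroup ℤ, (∀ x ∈ A, x ∈ H) → H = ⊤ := fun H hH =>
    AddSubgroup.eq_top_of_gcd_eq_one hgcd H fun i hi => hH _ (Finset.mem_image_of_mem _ hi)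
  obtain ⟨hsmall, hlarge⟩ := restricted_doubling_bound hl hApos hle hgen (by omega)
  have hbase := card_insert_zero_Res2_le (A := A)
  rw [hcard] at hsmall hlarge hbase
  obtain ⟨d, rfl⟩ : ∃ d, k = α + d + 2 := ⟨k - 2 - α, by omega⟩
  have hstep := card_SetSubAlpha_add_le hApos α d (by omega)
  rw [Nat.add_sub_cancel] at hbase
  constructor
  · intro h
    have hN := hsmall h
    obtain ⟨p, hp⟩ := (Int.even_mul_pred_self ((α + d + 2 : ℕ) : ℤ)).two_dvd
    obtain ⟨q, hq⟩ := (Int.even_mul_succ_self (α : ℤ)).two_dvd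
    zify at hstep hbase
    rw [hp, hq, Int.mul_ediv_cancel_left _ two_ne_zero, Int.mul_ediv_cancel_left _ two_ne_zero]
    push_cast at hp hN ⊢
    linarith
  · intro h
    have hN := hlarge h
    have hbaseR : ((insert 0 (Res2 (insert 0 A))).card : ℝ) ≤ (SetSubAlpha (α + d) A).card := by
      exact_mod_cast hbase
    have hstepR : 2 * ((SetSubAlpha (α + d) A).card : ℝ) + (α + d) * (α + d + 1) ≤
        2 * (SetSubAlpha α A).card + α * (α + 1) := by exact_mod_cast hstep
    push_cast at hN ⊢
    linarith
end
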